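/- arXiv:2104.10080 — 2 statements merged into one kernel-verified Lean document; each statement's English description precedes it below -/
import Mathlib

section
/- Let n ≥ 5 be an odd integer with n ≠ 9 and n ≠ 15. If H is a finite simple graph with I(H,x) = I(C_n,x), then H is isomorphic to C_n or to D_n. -/
open Polynomial SimpleGraph

/-- A finset of vertices is independent if no two of its vertices are adjacent. -/
def SimpleGraph.IsIndepFinset {V : Type*} (G : SimpleGraph V) (s : Finset V) : Prop :=
  ∀ v ∈ s, ∀ w ∈ s, ¬ G.Adj v w

open scoped Classical in
/-- The independence polynomial `I(G,x) = Σ_k i_k(G) xᵏ` of a finite simple graph,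
regarded as a polynomial with rational coefficients. -/
noncomputable def SimpleGraph.indepPoly {V : Type*} [Fintype V] (G : SimpleGraph V) :
    Polynomial ℚ :=
  ∑ s : Finset V, if G.IsIndepFinset s then (X : Polynomial ℚ) ^ s.card else 0

/-- `Dgraph n` : the graph on `n` vertices consisting of a triangle (on `0,1,2`)
together with a path on `n-3` vertices (`3, …, n-1`) whose endpoint is joined to
the triangle vertex `2`. -/
def Dgraph (n : ℕ) : SimpleGraph (Fin n) :=
  SimpleGraph.fromRel (fun i j => i.val + 1 = j.val ∨ (i.val = 0 ∧ j.val = 2))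


section Work
open scoped Classical
open Finset

/-- evaluation of the independence polynomial of the subgraph induced on `S` -/
noncomputable def zz {V : Type*} (G : SimpleGraph V) {R : Type*} [CommRing R] (x : R)
    (S : Finset V) : R :=
  ∑ s ∈ S.powerset, if G.IsIndepFinset s then x ^ s.card else 0

variable {V : Type*} {G : SimpleGraph V} {R : Type*} [CommRing R] {x : R}

lemma zz_empty : zz G x ∅ = 1 := by
  simp [zz, SimpleGraph.IsIndepFinset]

lemma indep_insert {v : V} {t : Finset V} :
    G.IsIndepFinset (insert v t) ↔ G.IsIndepFinset t ∧ ∀ w ∈ t, ¬ G.Adj v w := by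
  unfold SimpleGraph.IsIndepFinset
  constructor
  · intro h
    exact ⟨fun a ha b hb => h a (mem_insert_of_mem ha) b (mem_insert_of_mem hb),
      fun w hw => h v (mem_insert_self _ _) w (mem_insert_of_mem hw)⟩
  · rintro ⟨h1, h2⟩ a ha b hb
    rw [mem_insert] at ha hb
    rcases ha with rfl | ha <;> rcases hb with rfl | hb
    · exact G.loopless.irrefl _
    · exact h2 b hb
    · exact fun h => h2 a ha h.symm
    · exact h1 a ha b hb

lemma zz_insert {v : V} {S : Finset V} (hv : v ∉ S) :
    zz G x (insert v S) = zz G x S + x * zz G x (S.filter (fun u => ¬ G.Adj v u)) := by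
  unfold zz
  rw [Finset.sum_powerset_insert hv]
  congr 1
  rw [Finset.mul_sum]
  have hsub : (S.filter (fun u => ¬ G.Adj v u)).powerset ⊆ S.powerset :=
    powerset_mono.2 (filter_subset _ _)
  rw [← Finset.sum_subset hsub]
  · apply Finset.sum_congr rfl
    intro t ht
    rw [mem_powerset] at ht
    have hvt : v ∉ t := fun h => hv (filter_subset _ _ (ht h))
    have h2 : ∀ w ∈ t, ¬ G.Adj v w := fun w hw => (mem_filter.1 (ht hw)).2
    by_cases hi : G.IsIndepFinset t
    · rw [if_pos (indep_insert.2 ⟨hi, h2⟩), if_pos hi, card_insert_of_notMem hvt, pow_succ, mul_comm]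
    · rw [if_neg (fun h => hi (indep_insert.1 h).1), if_neg hi, mul_zero]
  · intro t ht ht2
    rw [if_neg]
    intro h
    apply ht2
    rw [mem_powerset] at ht ⊢
    intro w hw
    exact mem_filter.2 ⟨ht hw, (indep_insert.1 h).2 w hw⟩

lemma zz_union {S T : Finset V} (hd : Disjoint S T) (he : ∀ a ∈ S, ∀ b ∈ T, ¬ G.Adj a b) :
    zz G x (S ∪ T) = zz G x S * zz G x T := by
  induction hS : S.card using Nat.strong_induction_on generalizing S with
  | _ k ih =>
    rcases S.eq_empty_or_nonempty with rfl | ⟨v, hv⟩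
    · simp [zz_empty]
    · obtain ⟨S', hvS, rfl⟩ : ∃ S', v ∉ S' ∧ S = insert v S' :=
        ⟨S.erase v, notMem_erase _ _, (insert_erase hv).symm⟩
      have hvT : v ∉ T := disjoint_left.1 hd hv
      have hd' : Disjoint S' T := hd.mono_left (subset_insert _ _)
      rw [card_insert_of_notMem hvS] at hS
      rw [insert_union, zz_insert (by simp [hvS, hvT]), zz_insert hvS, filter_union,
        ih S'.card (by omega) hd' (fun a ha => he a (mem_insert_of_mem ha)) rfl]
      have hT : T.filter (fun u => ¬ G.Adj v u) = T :=
        filter_true_of_mem (fun b hb => he v hv b hb)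
      rw [hT, ih (S'.filter (fun u => ¬ G.Adj v u)).card
        (lt_of_le_of_lt (card_filter_le _ _) (by omega))
        (hd'.mono_left (filter_subset _ _))
        (fun a ha => he a (mem_insert_of_mem (filter_subset _ _ ha))) rfl]
      ring

lemma zz_map {R' : Type*} [CommRing R'] (f : R →+* R') (S : Finset V) :
    f (zz G x S) = zz G (f x) S := by
  unfold zz
  rw [map_sum]
  apply Finset.sum_congr rfl
  intro s _
  split_ifs <;> simp

lemma indepPoly_eq [Fintype V] : G.indepPoly = zz G (X : ℚ[X]) univ := by
  unfold SimpleGraph.indepPoly zz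
  rw [powerset_univ]

lemma zz_eq_aeval [Fintype V] (x : ℝ) : zz G x univ = aeval x G.indepPoly := by
  rw [indepPoly_eq]
  have := zz_map (G := G) (x := (X : ℚ[X])) ((aeval x : ℚ[X] →ₐ[ℚ] ℝ) : ℚ[X] →+* ℝ) univ
  simp at this
  exact this.symm

/-- closed under adjacency -/
def Clo (G : SimpleGraph V) (C : Finset V) : Prop := ∀ a ∈ C, ∀ b, G.Adj a b → b ∈ C

lemma zz_clo [Fintype V] {C U : Finset V} (hC : Clo G C) (h : C ⊆ U) :
    zz G x U = zz G x C * zz G x (U \ C) := by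
  rw [← zz_union disjoint_sdiff]
  · rw [union_sdiff_of_subset h]
  · intro a ha b hb hab
    exact (mem_sdiff.1 hb).2 (hC a ha b hab)

lemma Clo.sdiff {C U : Finset V} (hU : Clo G U) (hC : Clo G C) : Clo G (U \ C) := by
  intro a ha b hab
  rw [mem_sdiff] at ha ⊢
  exact ⟨hU a ha.1 b hab, fun h => ha.2 (hC b h a hab.symm)⟩

/-- Fibonacci polynomials -/
def ff (x : R) : ℕ → R
  | 0 => 0
  | 1 => 1
  | (n+2) => ff x (n+1) + x * ff x n

/-- Lucas polynomials, `ll x k = I(C_k, x)` for `k ≥ 2` (with `ll x 0 = 2`) -/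
def ll (x : R) : ℕ → R
  | 0 => 2
  | 1 => 1
  | (n+2) => ll x (n+1) + x * ll x n

/-- `Tail G S v l` : `l` (last vertex first) is a path attached at `v` to `S`. -/
inductive Tail (G : SimpleGraph V) (S : Finset V) (v : V) : List V → Prop
  | nil : Tail G S v []
  | cons (t : V) (l : List V) : Tail G S v l → t ∉ S → t ∉ l →
      (∀ a, a ∈ S ∨ a ∈ l → (G.Adj t a ↔ a = l.headD v)) → Tail G S v (t :: l)

lemma Tail.headD_mem {S : Finset V} {v : V} (hv : v ∈ S) {l : List V} (h : Tail G S v l) :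
    l.headD v ∈ S ∨ l.headD v ∈ l := by
  cases h <;> simp [hv]

lemma Tail.nodup {S : Finset V} {v : V} {l : List V} (h : Tail G S v l) : l.Nodup := by
  induction h with
  | nil => simp
  | cons t l h1 h2 h3 h4 ih => exact List.nodup_cons.2 ⟨h3, ih⟩

lemma Tail.disj {S : Finset V} {v : V} {l : List V} (h : Tail G S v l) : ∀ a ∈ l, a ∉ S := by
  induction h with
  | nil => simp
  | cons t l h1 h2 h3 h4 ih => 
    intro a ha
    rcases List.mem_cons.1 ha with rfl | ha
    · exact h2
    · exact ih a ha

lemma Tail.mono {S S' : Finset V} {v : V} {l : List V} (h : Tail G S v l) (hs : S' ⊆ S) :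
    Tail G S' v l := by
  induction h with
  | nil => exact .nil
  | cons t l h1 h2 h3 h4 ih =>
    exact .cons t l ih (fun h => h2 (hs h)) h3
      (fun a ha => h4 a (ha.imp (fun h => hs h) id))

lemma Tail.step {S Q : Finset V} {v : V} {t : V} {l : List V} (h : Tail G S v (t :: l))
    (hQ : Q ⊆ S) :
    zz G x (Q ∪ (t :: l).toFinset) = zz G x (Q ∪ l.toFinset)
      + x * zz G x ((Q ∪ l.toFinset).erase (l.headD v)) := by
  cases h with
  | cons _ _ h1 h2 h3 h4 =>
    rw [List.toFinset_cons, union_insert,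
      zz_insert (by simp [h3]; exact fun h => h2 (hQ h))]
    congr 3
    ext a
    simp only [mem_filter, mem_erase, mem_union, List.mem_toFinset]
    constructor
    · rintro ⟨h5, h6⟩
      exact ⟨fun h => h6 ((h4 a (h5.imp (fun h => hQ h) id)).2 h), h5⟩
    · rintro ⟨h5, h6⟩
      exact ⟨h6, fun h => h5 ((h4 a (h6.imp (fun h => hQ h) id)).1 h)⟩

lemma Tail.of_cons {S : Finset V} {v t : V} {l : List V} (h : Tail G S v (t :: l)) :
    Tail G S v l := by
  cases h with
  | cons _ _ h1 h2 h3 h4 => exact h1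

lemma Tail.erase_head {S Q : Finset V} {v t : V} {l : List V} (h : Tail G S v (t :: l))
    (hQ : Q ⊆ S) : (Q ∪ (t :: l).toFinset).erase t = Q ∪ l.toFinset := by
  cases h with
  | cons _ _ g1 g2 g3 g4 =>
    ext a
    simp only [List.toFinset_cons, mem_erase, mem_union, mem_insert, List.mem_toFinset]
    constructor
    · rintro ⟨h5, h6⟩
      tauto
    · intro h5
      refine ⟨?_, by tauto⟩
      rintro rfl
      rcases h5 with h5 | h5
      · exact g2 (hQ h5)
      · exact g3 h5

lemma zz_tail {S Q : Finset V} {v : V} : ∀ {l : List V}, Tail G S v l → Q ⊆ S →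
    zz G x (Q ∪ l.toFinset) =
      ff x (l.length + 1) * zz G x Q + x * ff x l.length * zz G x (Q.erase v)
  | [], _, _ => by simp [ff]
  | [t], h, hQ => by rw [h.step hQ]; simp [ff]
  | t :: t' :: l, h, hQ => by
    rw [h.step hQ, zz_tail h.of_cons hQ, List.headD_cons, h.of_cons.erase_head hQ,
      zz_tail h.of_cons.of_cons hQ]
    simp only [List.length_cons, ff]
    ring

lemma zz_tail_erase {S Q : Finset V} {v t : V} {l : List V} (h : Tail G S v (t :: l))
    (hQ : Q ⊆ S) : zz G x ((Q ∪ (t :: l).toFinset).erase t) =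
      ff x (l.length + 1) * zz G x Q + x * ff x l.length * zz G x (Q.erase v) := by
  rw [h.erase_head hQ, zz_tail h.of_cons hQ]

end Work

section Work
open scoped Classical
open Finset
variable {V : Type*} [Fintype V] {G : SimpleGraph V}

lemma deg_one {v : V} (h : G.degree v = 1) {a : V} (ha : G.Adj v a) : ∀ b, G.Adj v b ↔ b = a := by
  rw [← G.card_neighborFinset_eq_degree, card_eq_one] at h
  obtain ⟨c, hc⟩ := h
  have h1 : ∀ b, G.Adj v b ↔ b = c := fun b => by
    rw [← G.mem_neighborFinset, hc, mem_singleton]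
  intro b
  rw [h1, (h1 a).1 ha]

lemma deg_two {v : V} (h : G.degree v = 2) {a : V} (ha : G.Adj v a) :
    ∃ c, c ≠ a ∧ ∀ b, G.Adj v b ↔ b = a ∨ b = c := by
  rw [← G.card_neighborFinset_eq_degree, card_eq_two] at h
  obtain ⟨c, d, hcd, hc⟩ := h
  have h1 : ∀ b, G.Adj v b ↔ b = c ∨ b = d := fun b => by
    rw [← G.mem_neighborFinset, hc, mem_insert, mem_singleton]
  rcases (h1 a).1 ha with rfl | rfl
  · exact ⟨d, hcd.symm, h1⟩
  · exact ⟨c, hcd, fun b => by rw [h1, or_comm]⟩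

lemma deg_two' {v : V} (h : G.degree v = 2) {a b : V} (ha : G.Adj v a) (hb : G.Adj v b)
    (hab : a ≠ b) : ∀ c, G.Adj v c ↔ c = a ∨ c = b := by
  obtain ⟨d, hd, h1⟩ := deg_two h ha
  rcases (h1 b).1 hb with h2 | h2
  · exact absurd h2.symm hab
  · rw [h2]; exact h1

lemma deg_three {v : V} (h : G.degree v = 3) {a b : V} (ha : G.Adj v a) (hb : G.Adj v b)
    (hab : a ≠ b) : ∃ c, c ≠ a ∧ c ≠ b ∧ ∀ d, G.Adj v d ↔ d = a ∨ d = b ∨ d = c := by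
  rw [← G.card_neighborFinset_eq_degree] at h
  have h1 : ((G.neighborFinset v).erase a).card = 2 := by
    rw [card_erase_of_mem (by simpa using ha), h]
  have h2 : (((G.neighborFinset v).erase a).erase b).card = 1 := by
    rw [card_erase_of_mem (by simp [hb, hab.symm]), h1]
  obtain ⟨c, hc⟩ := card_eq_one.1 h2
  have h3 : ∀ d, (d ≠ b ∧ d ≠ a ∧ G.Adj v d) ↔ d = c := fun d => by
    rw [← mem_singleton, ← hc]; simp
  have h4 := (h3 c).2 rfl
  refine ⟨c, h4.2.1, h4.1, fun d => ?_⟩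
  constructor
  · intro h
    by_cases e1 : d = a
    · exact Or.inl e1
    by_cases e2 : d = b
    · exact Or.inr (Or.inl e2)
    exact Or.inr (Or.inr ((h3 d).1 ⟨e2, e1, h⟩))
  · rintro (rfl | rfl | rfl)
    · exact ha
    · exact hb
    · exact h4.2.2

lemma deg_three_one {v : V} (h : G.degree v = 3) {a : V} (ha : G.Adj v a) :
    ∃ b c, b ≠ a ∧ c ≠ a ∧ b ≠ c ∧ ∀ d, G.Adj v d ↔ d = a ∨ d = b ∨ d = c := by
  have h' := h
  rw [← G.card_neighborFinset_eq_degree] at h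
  have h1 : ((G.neighborFinset v).erase a).card = 2 := by
    rw [card_erase_of_mem (by simpa using ha), h]
  obtain ⟨b, hb⟩ := card_pos.1 (by omega : 0 < ((G.neighborFinset v).erase a).card)
  rw [mem_erase, G.mem_neighborFinset] at hb
  obtain ⟨c, h2, h3, h4⟩ := deg_three h' ha hb.2 (Ne.symm hb.1)
  exact ⟨b, c, hb.1, h2, Ne.symm h3, h4⟩

lemma grow_aux (E : V → V → Prop) {S : Finset V} {v u₀ : V} (hv : v ∈ S) :
    ∀ (N : ℕ) (l : List V) (u : V), Fintype.card V - (S ∪ l.toFinset).card = N →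
    Tail G S v l → ¬ (u ∈ S ∨ u ∈ l) → G.Adj (l.headD v) u → (l = [] → u = u₀) →
    (∀ a ∈ l, G.degree a = 2) →
    (∀ a, (a ∈ S ∨ a ∈ l) → ∀ b, ¬ (b ∈ S ∨ b ∈ l) → G.Adj a b →
      (a = l.headD v ∧ b = u) ∨ (a ∈ S ∧ E a b)) →
    ∃ l, Tail G S v l ∧ (
      (∃ t l', l = t :: l' ∧ G.degree t = 1 ∧ (∀ a ∈ l', G.degree a = 2) ∧
        ∀ a, (a ∈ S ∨ a ∈ l) → ∀ b, ¬ (b ∈ S ∨ b ∈ l) → G.Adj a b → a ∈ S ∧ E a b) ∨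
      (∃ u, ¬ (u ∈ S ∨ u ∈ l) ∧ G.Adj (l.headD v) u ∧ (l = [] → u = u₀) ∧
        (∀ a ∈ l, G.degree a = 2) ∧
        (∀ a, (a ∈ S ∨ a ∈ l) → ∀ b, ¬ (b ∈ S ∨ b ∈ l) → G.Adj a b →
          (a = l.headD v ∧ b = u) ∨ (a ∈ S ∧ E a b)) ∧
        ((∃ a ∈ S, E a u ∧ G.Adj a u ∧ a ≠ l.headD v ∧ G.degree u = 2) ∨ 3 ≤ G.degree u))) := by
  intro N
  induction N using Nat.strong_induction_on with
  | _ N ih =>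
    intro l u hN hT hu hadj hl0 hdeg hleave
    have hm := hT.headD_mem hv
    have hpos : 0 < G.degree u := (G.degree_pos_iff_exists_adj u).2 ⟨_, hadj.symm⟩
    rcases (by omega : G.degree u = 1 ∨ G.degree u = 2 ∨ 3 ≤ G.degree u) with h1 | h2 | h3
    · have hn := deg_one h1 hadj.symm
      refine ⟨u :: l, .cons u l hT (fun h => hu (Or.inl h)) (fun h => hu (Or.inr h))
        (fun a _ => hn a), Or.inl ⟨u, l, rfl, h1, hdeg, ?_⟩⟩
      intro a ha b hb hab
      simp only [List.mem_cons, not_or] at ha hb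
      by_cases hau : a = u
      · subst hau
        have := (hn b).1 hab
        subst this
        tauto
      · have := hleave a (by tauto) b (by tauto) hab
        tauto
    · obtain ⟨c, hc, hn⟩ := deg_two h2 hadj.symm
      by_cases hcS : c ∈ S ∨ c ∈ l
      · refine ⟨l, hT, Or.inr ⟨u, hu, hadj, hl0, hdeg, hleave, Or.inl ?_⟩⟩
        have hcu : G.Adj c u := ((hn c).2 (Or.inr rfl)).symm
        rcases hleave c hcS u hu hcu with h | h
        · exact absurd h.1 hc
        · exact ⟨c, h.1, h.2, hcu, hc, h2⟩
      · have hTail : Tail G S v (u :: l) := .cons u l hT (fun h => hu (Or.inl h))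
          (fun h => hu (Or.inr h)) (fun a ha => by
            rw [hn]
            constructor
            · rintro (h | rfl)
              · exact h
              · exact absurd ha hcS
            · exact Or.inl)
        have huc : G.Adj u c := (hn c).2 (Or.inr rfl)
        have hcard : (S ∪ (u :: l).toFinset).card = (S ∪ l.toFinset).card + 1 := by
          rw [List.toFinset_cons, union_insert, card_insert_of_notMem]
          simpa using hu
        have hle : (S ∪ (u :: l).toFinset).card ≤ Fintype.card V := card_le_univ _
        refine ih _ ?_ (u :: l) c rfl hTail ?_ huc (by simp) ?_ ?_
        · omega
        · simp only [List.mem_cons]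
          have := huc.ne'
          tauto
        · intro a ha
          rcases List.mem_cons.1 ha with rfl | ha
          · exact h2
          · exact hdeg a ha
        · intro a ha b hb hab
          simp only [List.mem_cons, not_or, List.headD_cons] at ha hb ⊢
          by_cases hau : a = u
          · subst hau
            left
            refine ⟨rfl, ?_⟩
            rcases (hn b).1 hab with h | h
            · subst h; tauto
            · exact h
          · have := hleave a (by tauto) b (by tauto) hab
            tauto
    · exact ⟨l, hT, Or.inr ⟨u, hu, hadj, hl0, hdeg, hleave, Or.inr h3⟩⟩

lemma grow (E : V → V → Prop) {S : Finset V} {v u₀ : V} (hv : v ∈ S) (hu : u₀ ∉ S)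
    (hadj : G.Adj v u₀)
    (hleave : ∀ a ∈ S, ∀ b, b ∉ S → G.Adj a b → (a = v ∧ b = u₀) ∨ E a b) :
    ∃ l, Tail G S v l ∧ (
      (∃ t l', l = t :: l' ∧ G.degree t = 1 ∧ (∀ a ∈ l', G.degree a = 2) ∧
        ∀ a, (a ∈ S ∨ a ∈ l) → ∀ b, ¬ (b ∈ S ∨ b ∈ l) → G.Adj a b → a ∈ S ∧ E a b) ∨
      (∃ u, ¬ (u ∈ S ∨ u ∈ l) ∧ G.Adj (l.headD v) u ∧ (l = [] → u = u₀) ∧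
        (∀ a ∈ l, G.degree a = 2) ∧
        (∀ a, (a ∈ S ∨ a ∈ l) → ∀ b, ¬ (b ∈ S ∨ b ∈ l) → G.Adj a b →
          (a = l.headD v ∧ b = u) ∨ (a ∈ S ∧ E a b)) ∧
        ((∃ a ∈ S, E a u ∧ G.Adj a u ∧ a ≠ l.headD v ∧ G.degree u = 2) ∨ 3 ≤ G.degree u))) := by
  refine grow_aux E hv _ [] u₀ rfl .nil (by simpa using hu) hadj (fun _ => rfl) (by simp) ?_
  intro a ha b hb hab
  simp only [List.not_mem_nil, or_false] at ha hb
  rcases hleave a ha b hb hab with h | h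
  · exact Or.inl h
  · exact Or.inr ⟨ha, h⟩

end Work

section Work
open scoped Classical
open Finset

lemma map_ff {R R' : Type*} [CommRing R] [CommRing R'] (f : R →+* R') (x : R) :
    ∀ n, f (ff x n) = ff (f x) n
  | 0 => by simp [ff]
  | 1 => by simp [ff]
  | n + 2 => by simp [ff, map_ff f x n, map_ff f x (n+1)]

lemma map_ll {R R' : Type*} [CommRing R] [CommRing R'] (f : R →+* R') (x : R) :
    ∀ n, f (ll x n) = ll (f x) n
  | 0 => by simp only [ll]; exact map_ofNat f 2
  | 1 => by simp [ll]
  | n + 2 => by simp [ll, map_ll f x n, map_ll f x (n+1)]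

lemma ll_eq_ff {R : Type*} [CommRing R] (x : R) :
    ∀ n, ll x (n+1) = ff x (n+2) + x * ff x n
  | 0 => by simp [ll, ff]
  | 1 => by simp [ll, ff]; ring
  | n + 2 => by
    have h1 := ll_eq_ff x n
    have h2 := ll_eq_ff x (n+1)
    simp only [ll, ff] at h1 h2 ⊢
    rw [h1] at *
    linear_combination h2 

lemma ff_quarter : ∀ n : ℕ, 2 ^ n * ff (-1/4 : ℝ) n = 2 * n
  | 0 => by simp [ff]
  | 1 => by simp [ff]
  | n + 2 => by
    have h1 := ff_quarter n
    have h2 := ff_quarter (n+1)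
    simp only [ff, pow_succ] at h1 h2 ⊢
    push_cast at *
    linear_combination 2 * h2 - h1

lemma ll_quarter : ∀ n : ℕ, 2 ^ n * ll (-1/4 : ℝ) n = 2
  | 0 => by simp [ll]
  | 1 => by simp [ll]
  | n + 2 => by
    have h1 := ll_quarter n
    have h2 := ll_quarter (n+1)
    simp only [ll, pow_succ] at h1 h2 ⊢
    linear_combination 2 * h2 - h1

lemma ff_two : ∀ n : ℕ, 3 * ff (2 : ℤ) n = 2 ^ n - (-1) ^ n
  | 0 => by simp [ff]
  | 1 => by simp [ff]
  | n + 2 => by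
    have h1 := ff_two n
    have h2 := ff_two (n+1)
    simp only [ff, pow_succ] at h1 h2 ⊢
    linear_combination h2 + 2 * h1

lemma ll_two : ∀ n : ℕ, ll (2 : ℤ) n = 2 ^ n + (-1) ^ n
  | 0 => by simp [ll]
  | 1 => by simp [ll]
  | n + 2 => by
    have h1 := ll_two n
    have h2 := ll_two (n+1)
    simp only [ll, pow_succ] at h1 h2 ⊢
    linear_combination h2 + 2 * h1

lemma ll_two_odd {n : ℕ} (h : Odd n) : ll (2 : ℤ) n = 2 ^ n - 1 := by
  rw [ll_two, h.neg_one_pow]; ring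

lemma ll_pow (a b : ℝ) (hab : a + b = 1) : ∀ n, ll (-(a*b)) n = a ^ n + b ^ n
  | 0 => by simp [ll]; norm_num
  | 1 => by simp [ll, hab]
  | n + 2 => by
    simp only [ll, ll_pow a b hab n, ll_pow a b hab (n+1), pow_succ]
    have : b = 1 - a := by linarith
    subst this
    ring

lemma ll_pos {t : ℝ} (h0 : 0 ≤ t) (h1 : t ≤ 1/4) (n : ℕ) : 0 < ll (-t) n := by
  set s := Real.sqrt (1 - 4*t) with hs
  have hs2 : s * s = 1 - 4 * t := Real.mul_self_sqrt (by linarith)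
  have hs0 : 0 ≤ s := Real.sqrt_nonneg _
  have hs1 : s ≤ 1 := by nlinarith
  have ht : t = ((1+s)/2) * ((1-s)/2) := by nlinarith
  rw [ht, ll_pow _ _ (by ring)]
  have := pow_pos (by linarith : (0:ℝ) < (1+s)/2) n
  have := pow_nonneg (by linarith : (0:ℝ) ≤ (1-s)/2) n
  linarith

lemma deriv_ll : ∀ n : ℕ, derivative (ll (X : ℚ[X]) (n+1)) = (n+1 : ℚ[X]) * ff X n
  | 0 => by simp [ll, ff]
  | 1 => by simp [ll, ff]; norm_num
  | n + 2 => by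
    have h1 := deriv_ll n
    have h2 := deriv_ll (n+1)
    have h3 := ll_eq_ff (X : ℚ[X]) n
    have e : ll (X : ℚ[X]) (n+2+1) = ll X (n+2) + X * ll X (n+1) := rfl
    rw [e]
    simp only [derivative_add, derivative_mul, derivative_X, one_mul]
    rw [h1, h2, h3]
    simp only [ff]
    push_cast
    ring

lemma ff_ne {x : ℚ} (hx : x ≠ 0) : ∀ n, ¬ (ff x n = 0 ∧ ff x (n+1) = 0)
  | 0 => by simp [ff]
  | n + 1 => by
    rintro ⟨h1, h2⟩
    apply ff_ne hx n
    refine ⟨?_, h1⟩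
    simp only [ff, h1, zero_add, mul_eq_zero, hx, false_or] at h2
    exact h2

lemma ll_simple {n : ℕ} {q : ℚ[X]} (h : ll (X : ℚ[X]) (n+1) = (1 + 3 * X) * (1 + 3 * X) * q) :
    False := by
  have e : ∀ k, eval (-1/3 : ℚ) (ff X k) = ff (-1/3) k := fun k => by
    have := map_ff (evalRingHom (-1/3 : ℚ)) X k
    simpa using this
  have h1 : eval (-1/3 : ℚ) (derivative (ll (X : ℚ[X]) (n+1))) = 0 := by
    rw [h]
    simp
    ring
  have h2 : eval (-1/3 : ℚ) (ll (X : ℚ[X]) (n+1)) = 0 := by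
    rw [h]; simp; left; norm_num
  rw [deriv_ll] at h1
  simp only [eval_mul, e, eval_add, eval_natCast, eval_one, mul_eq_zero] at h1
  have h3 : ff (-1/3 : ℚ) n = 0 := by
    rcases h1 with h1 | h1
    · have : (0:ℚ) ≤ n := Nat.cast_nonneg n
      linarith
    · exact h1
  rw [ll_eq_ff] at h2
  simp only [eval_add, eval_mul, eval_X, e, h3, mul_zero, add_zero] at h2
  simp only [ff, h3, mul_zero, add_zero] at h2
  exact ff_ne (by norm_num) n ⟨h3, h2⟩

lemma not3 {n : ℕ} (h : Odd n) : ¬ (3:ℤ) ∣ 2 ^ n - 1 := by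
  obtain ⟨k, rfl⟩ := h
  intro hd
  have h4 : (3:ℤ) ∣ 4 ^ k - 1 := by simpa using sub_dvd_pow_sub_pow (4:ℤ) 1 k
  rw [pow_succ, pow_mul] at hd
  norm_num at hd h4
  omega

lemma not13 {n : ℕ} (h : Odd n) : ¬ (13:ℤ) ∣ 2 ^ n - 1 := by
  obtain ⟨k, rfl⟩ := h
  intro hd
  have h4 : (13:ℤ) ∣ 4096 ^ (k/6) - 1 :=
    (by norm_num : (13:ℤ) ∣ 4096 - 1).trans (by simpa using sub_dvd_pow_sub_pow (4096:ℤ) 1 (k/6))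
  have e : (2:ℤ) ^ (2*k+1) = 4096 ^ (k/6) * 2 ^ (2 * (k % 6) + 1) := by
    rw [show (4096:ℤ) = 2^12 by norm_num, ← pow_mul, ← pow_add]
    congr 1; omega
  rw [e] at hd
  generalize (4096:ℤ)^(k/6) = y at *
  have : k % 6 < 6 := Nat.mod_lt _ (by norm_num)
  interval_cases k % 6 <;> norm_num at hd <;> omega

lemma dvd_two {n a : ℕ} (h : Odd n) {d : ℤ} (h1 : d ∣ 2 ^ a + 1) (h2 : d ∣ 2 ^ n - 1) :
    d ∣ 2 := by
  have h3 : d ∣ (2:ℤ) ^ (a * n) + 1 := by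
    rw [pow_mul]
    have := Odd.add_dvd_pow_add_pow ((2:ℤ)^a) 1 h
    rw [one_pow] at this
    exact h1.trans this
  have h4 : d ∣ (2:ℤ) ^ (n * a) - 1 := by
    rw [pow_mul]
    have := sub_dvd_pow_sub_pow ((2:ℤ)^n) 1 a
    rw [one_pow] at this
    exact h2.trans this
  rw [mul_comm a n] at h3
  have := dvd_sub h3 h4
  rwa [show (2:ℤ) ^ (n * a) + 1 - (2 ^ (n * a) - 1) = 2 by ring] at this

lemma dvd_one_aux {n a : ℕ} (h : Odd n) {d : ℤ} (hd : 0 < d) (h1 : d ∣ 2 ^ a + 1)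
    (h2 : d ∣ 2 ^ n - 1) : d = 1 := by
  have h3 := dvd_two h h1 h2
  have h4 := Int.le_of_dvd (by norm_num) h3
  rcases (by omega : d = 1 ∨ d = 2) with h5 | h5
  · exact h5
  · subst h5
    obtain ⟨k, rfl⟩ := h
    rw [pow_succ] at h2
    omega

lemma path_not {n k : ℕ} (h : Odd n) (hk : 3 ≤ k) : ¬ ff (2:ℤ) k ∣ 2 ^ n - 1 := by
  intro hd
  have e := ff_two k
  have hbig : ∀ j, (2:ℤ)^(j+2) = 4 * 2 ^ j := fun j => by ring
  have hpos : ∀ j, (1:ℤ) ≤ 2 ^ j := fun j => one_le_pow₀ (by norm_num)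
  rcases Nat.even_or_odd k with ⟨a, ha⟩ | ho
  · have hka : k = a * 2 := by omega
    have e2 : 3 * ff (2:ℤ) k = (2 ^ a - 1) * (2 ^ a + 1) := by
      rw [e, hka, pow_mul, pow_mul, ← pow_mul, ← pow_mul, mul_comm a 2, pow_mul (-1 : ℤ), ← mul_comm a 2, pow_mul]; norm_num; ring
    obtain ⟨j, rfl⟩ : ∃ j, a = j + 2 := ⟨a - 2, by omega⟩
    have hj := hpos j
    rcases Nat.even_or_odd (j+2) with ⟨b, hb⟩ | ⟨b, hb⟩
    · have h4 : (3:ℤ) ∣ 4 ^ b - 1 := by simpa using sub_dvd_pow_sub_pow (4:ℤ) 1 b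
      have h5 : (3:ℤ) ∣ 2 ^ (j+2) - 1 := by
        rw [show j + 2 = 2 * b by omega, pow_mul]; norm_num; exact h4
      obtain ⟨c, hc⟩ := h5
      have h6 : (2:ℤ) ^ (j+2) + 1 ∣ ff 2 k := ⟨c, by
        rw [hc] at e2; linarith⟩
      have := dvd_one_aux h (by positivity) dvd_rfl (h6.trans hd)
      rw [hbig] at this
      omega
    · have h5 : (3:ℤ) ∣ 2 ^ (j+2) + 1 := by
        have := Odd.add_dvd_pow_add_pow (2:ℤ) 1 (⟨b, hb⟩ : Odd (j+2))
        rw [one_pow] at this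
        norm_num at this
        exact this
      obtain ⟨c, hc⟩ := h5
      have h6 : c ∣ ff 2 k := ⟨2 ^ (j+2) - 1, by
        rw [hc] at e2; linarith⟩
      have := dvd_one_aux h (by have := hpos (j+2); omega) ⟨3, by rw [hc]; ring⟩ (h6.trans hd)
      rw [hbig] at hc
      omega
  · rw [ho.neg_one_pow] at e
    have := dvd_one_aux h (by have := hpos k; omega) ⟨3, by linarith⟩ hd
    obtain ⟨j, rfl⟩ : ∃ j, k = j + 3 := ⟨k - 3, by omega⟩
    rw [this, pow_succ, hbig] at e
    have := hpos j
    omega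

end Work

section Work
open scoped Classical
open Finset
variable {V : Type*} {G : SimpleGraph V}

lemma zz_zero (S : Finset V) : zz G (0:ℝ) S = 1 := by
  induction S using Finset.induction_on with
  | empty => exact zz_empty
  | insert a s ha ih => rw [zz_insert ha, ih]; simp

lemma zz_cont (S : Finset V) : Continuous (fun t : ℝ => zz G (-t) S) := by
  unfold zz
  apply continuous_finset_sum
  intro s _
  split_ifs <;> fun_prop

lemma pos_aux (N : ℕ) : ∀ S : Finset V, S.card = N → ∀ a : ℝ, 0 ≤ a →
    (∀ t ∈ Set.Icc 0 a, 0 < zz G (-t) S) → ∀ U ⊆ S, ∀ t ∈ Set.Icc 0 a, 0 < zz G (-t) U := by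
  induction N with
  | zero =>
    intro S hS a _ h U hU
    rw [card_eq_zero] at hS
    subst hS
    rw [subset_empty] at hU
    subst hU
    exact h
  | succ N ih =>
    intro S hS a ha h U hU
    by_cases hUS : U = S
    · subst hUS; exact h
    obtain ⟨v, hvS, hvU⟩ := exists_of_ssubset (hU.ssubset_of_ne hUS)
    have hc : (S.erase v).card = N := by rw [card_erase_of_mem hvS, hS]; rfl
    refine ih _ hc a ha ?_ U (fun w hw => mem_erase.2 ⟨fun e => hvU (e ▸ hw), hU hw⟩)
    by_contra hcon
    push Not at hcon
    set f := fun t : ℝ => zz G (-t) (S.erase v) with hf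
    have hfc : Continuous f := zz_cont _
    have hK : IsCompact (Set.Icc 0 a ∩ {t | f t ≤ 0}) :=
      isCompact_Icc.inter_right (isClosed_le hfc continuous_const)
    obtain ⟨t0, h1, h2⟩ := hcon
    obtain ⟨r, ⟨hr1, hr2⟩, hr3⟩ := hK.exists_isLeast ⟨t0, h1, h2⟩
    set g := fun t : ℝ => zz G (-t) ((S.erase v).filter (fun u => ¬ G.Adj v u)) with hg
    have hgc : Continuous g := zz_cont _
    have hr0 : 0 < r := by
      rcases hr1.1.lt_or_eq with h | h
      · exact h
      · rw [← h] at hr2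
        simp only [hf, Set.mem_setOf_eq, neg_zero, zz_zero] at hr2
        linarith
    have hgI : ∀ s ∈ Set.Ico 0 r, 0 ≤ g s := by
      intro s hs
      refine (ih _ hc s hs.1 ?_ _ (filter_subset _ _) s ⟨hs.1, le_rfl⟩).le
      intro t ht
      by_contra hn
      have := hr3 ⟨⟨ht.1, by linarith [ht.2, hs.2, hr1.2]⟩, not_lt.1 hn⟩
      linarith [ht.2, hs.2]
    have hgr : 0 ≤ g r := by
      have hcl : IsClosed {t | 0 ≤ g t} := isClosed_le continuous_const hgc
      have : closure (Set.Ico 0 r) ⊆ {t | 0 ≤ g t} := hcl.closure_subset_iff.2 hgI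
      rw [closure_Ico hr0.ne] at this
      exact this ⟨hr0.le, le_rfl⟩
    have hfin := h r hr1
    rw [← insert_erase hvS, zz_insert (notMem_erase _ _)] at hfin
    have : f r ≤ 0 := hr2
    simp only [hf, hg] at this hgr
    nlinarith

lemma zz_single {R : Type*} [CommRing R] {x : R} (a : V) : zz G x {a} = 1 + x := by
  rw [← insert_empty, zz_insert (by simp)]; simp [zz_empty]

lemma zz_pair {R : Type*} [CommRing R] {x : R} {a b : V} (h : G.Adj a b) :
    zz G x {a, b} = 1 + 2 * x := by
  rw [zz_insert (by simp [h.ne]), filter_singleton]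
  simp [h, zz_empty, zz_single]; ring

lemma zz_pair' {R : Type*} [CommRing R] {x : R} {a b : V} (hab : a ≠ b) (h : ¬ G.Adj a b) :
    zz G x {a, b} = 1 + 2 * x + x ^ 2 := by
  rw [zz_insert (by simp [hab]), filter_singleton]
  simp [h, zz_single]; ring

lemma zz_tri {R : Type*} [CommRing R] {x : R} {a b c : V} (h : G.Adj a b) (h2 : G.Adj b c)
    (h3 : G.Adj a c) : zz G x {a, b, c} = 1 + 3 * x := by
  rw [zz_insert (by simp [h.ne, h3.ne]), filter_insert, filter_singleton]
  simp [h, h3, zz_empty, zz_pair h2]; ring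

lemma zz_cherry {R : Type*} [CommRing R] {x : R} {a b c : V} (h : G.Adj a b) (h2 : ¬ G.Adj b c)
    (hbc : b ≠ c) (h3 : G.Adj a c) : zz G x {a, b, c} = 1 + 3 * x + x ^ 2 := by
  rw [zz_insert (by simp [h.ne, h3.ne]), filter_insert, filter_singleton]
  simp [h, h3, zz_empty, zz_pair' hbc h2]; ring

lemma zz_anti (hpos : ∀ S, 0 < zz G (-1/4 : ℝ) S) {S S' : Finset V} (h : S ⊆ S') :
    zz G (-1/4 : ℝ) S' ≤ zz G (-1/4 : ℝ) S := by
  have : ∀ T : Finset V, zz G (-1/4 : ℝ) (T ∪ S) ≤ zz G (-1/4 : ℝ) S := by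
    intro T
    induction T using Finset.induction_on with
    | empty => simp
    | insert a s ha ih =>
      rw [insert_union]
      by_cases hm : a ∈ s ∪ S
      · rwa [insert_eq_of_mem hm]
      · rw [zz_insert hm]
        have := hpos ((s ∪ S).filter (fun u => ¬ G.Adj a u))
        linarith
  have h2 := this S'
  rwa [union_eq_left.2 h] at h2

/-- tightness at `v` -/
def Tight (G : SimpleGraph V) (S : Finset V) (v : V) : Prop :=
  v ∈ S ∧ 2 * zz G (-1/4 : ℝ) S ≤ zz G (-1/4 : ℝ) (S.erase v)

lemma tight_step (hpos : ∀ S, 0 < zz G (-1/4 : ℝ) S) {S : Finset V} {v u : V} (h : Tight G S v)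
    (hu : u ∉ S) (huv : G.Adj v u) : Tight G (insert u S) u := by
  refine ⟨mem_insert_self _ _, ?_⟩
  rw [zz_insert hu, erase_insert hu]
  have h1 : zz G (-1/4 : ℝ) (S.erase v) ≤ zz G (-1/4 : ℝ) (S.filter (fun w => ¬ G.Adj u w)) := by
    apply zz_anti hpos
    intro w hw
    rw [mem_filter] at hw
    exact mem_erase.2 ⟨fun e => hw.2 (e ▸ huv.symm), hw.1⟩
  have := h.2
  linarith

lemma tight_tail (hpos : ∀ S, 0 < zz G (-1/4 : ℝ) S) {S : Finset V} {v : V} (h : Tight G S v)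
    {l : List V} (hl : Tail G S v l) : Tight G (S ∪ l.toFinset) (l.headD v) := by
  induction hl with
  | nil => simpa using h
  | cons t l h1 h2 h3 h4 ih =>
    have := tight_step hpos ih (u := t) (by simp [h2, h3])
      ((h4 _ (h1.headD_mem h.1)).2 rfl).symm
    rw [List.toFinset_cons, union_insert]
    exact this

lemma tight_two (hpos : ∀ S, 0 < zz G (-1/4 : ℝ) S) {S : Finset V} {v d e : V} (h : Tight G S v)
    (hd : d ∉ S) (he : e ∉ S) (hvd : G.Adj v d) (hve : G.Adj v e) (hde : G.Adj d e) : False := by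
  have h1 := (tight_step hpos h hd hvd).2
  rw [erase_insert hd] at h1
  have h2 : e ∉ insert d S := by simp [he, hde.ne']
  have h3 := hpos (insert e (insert d S))
  rw [zz_insert h2] at h3
  have h4 : zz G (-1/4 : ℝ) (S.erase v) ≤
      zz G (-1/4 : ℝ) ((insert d S).filter (fun w => ¬ G.Adj e w)) := by
    apply zz_anti hpos
    intro w hw
    rw [mem_filter, mem_insert] at hw
    refine mem_erase.2 ⟨fun e => hw.2 (e ▸ hve.symm), ?_⟩
    rcases hw.1 with rfl | h
    · exact absurd hde.symm hw.2
    · exact h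
  have := h.2
  linarith

lemma tight_hit (hpos : ∀ S, 0 < zz G (-1/4 : ℝ) S) {S : Finset V} {v : V} (h : Tight G S v)
    {l : List V} (hl : Tail G S v l) {u b c : V} (hu : ¬ (u ∈ S ∨ u ∈ l))
    (hvu : G.Adj (l.headD v) u) (hb : ¬ (b ∈ S ∨ b ∈ l)) (hc : ¬ (c ∈ S ∨ c ∈ l))
    (hub : G.Adj u b) (huc : G.Adj u c) (hbc : G.Adj b c) : False := by
  have h1 := tight_step hpos (tight_tail hpos h hl) (u := u) (by simpa using hu) hvu
  exact tight_two hpos h1 (by simp only [mem_insert, mem_union, List.mem_toFinset, hb, hub.ne', or_false]; tauto) 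
    (by simp only [mem_insert, mem_union, List.mem_toFinset, hc, huc.ne', or_false]; tauto) hub huc hbc

lemma tight_tri {a b c : V} (h : G.Adj a b) (h2 : G.Adj b c)
    (h3 : G.Adj a c) : Tight G {a, b, c} a := by
  refine ⟨by simp, ?_⟩
  rw [erase_insert (by simp [h.ne, h3.ne]), zz_tri h h2 h3, zz_pair h2]
  norm_num

lemma k4e (hpos : ∀ S, 0 < zz G (-1/4 : ℝ) S) (h13 : ∀ C, Clo G C → zz G (2:ℤ) C ≠ 13)
    {a b c d : V} (hab : G.Adj a b) (hac : G.Adj a c) (hbc : G.Adj b c) (had : G.Adj a d)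
    (hbd : G.Adj b d) (hcd : c ≠ d) : False := by
  have key : ∀ {R : Type} [CommRing R] (x : R), zz G x {a, b, c, d} = zz G x {b, c, d} + x := by
    intro R _ x
    rw [zz_insert (by simp [hab.ne, hac.ne, had.ne])]
    simp [filter_insert, filter_singleton, hab, hac, had, zz_empty]
  by_cases hc : G.Adj c d
  · have h1 := hpos {a, b, c, d}
    rw [key, zz_tri hbc hc hbd] at h1
    norm_num at h1
  · have hk : ∀ {R : Type} [CommRing R] (x : R), zz G x {a, b, c, d} = 1 + 4 * x + x ^ 2 := by
      intro R _ x
      rw [key, zz_cherry hbc hc hcd hbd]; ring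
    refine h13 {a, b, c, d} ?_ (by rw [hk]; norm_num)
    intro y hy w hw
    by_contra hwD
    have h1 := hpos (insert w {a, b, c, d})
    rw [zz_insert hwD, hk] at h1
    have h2 : zz G (-1/4 : ℝ) (({a, b, c, d} : Finset V).erase y) ≤ 
        zz G (-1/4 : ℝ) (({a, b, c, d} : Finset V).filter (fun u => ¬ G.Adj w u)) := by
      apply zz_anti hpos
      intro z hz
      rw [mem_filter] at hz
      exact mem_erase.2 ⟨fun e => hz.2 (e ▸ hw.symm), hz.1⟩
    have h3 : (1/4 : ℝ) ≤ zz G (-1/4 : ℝ) (({a, b, c, d} : Finset V).erase y) := by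
      have ne1 := hab.ne
      have ne2 := hac.ne
      have ne3 := had.ne
      have ne4 := hbc.ne
      have ne5 := hbd.ne
      simp only [mem_insert, mem_singleton] at hy
      rcases hy with rfl | rfl | rfl | rfl
      · have e : ({y, b, c, d} : Finset V).erase y = {b, c, d} := by
          ext z; simp only [mem_erase, mem_insert, mem_singleton]; grind
        rw [e, zz_cherry hbc hc hcd hbd]; norm_num
      · have e : ({a, y, c, d} : Finset V).erase y = {a, c, d} := by
          ext z; simp only [mem_erase, mem_insert, mem_singleton]; grind
        rw [e, zz_cherry hac hc hcd had]; norm_num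
      · have e : ({a, b, y, d} : Finset V).erase y = {a, b, d} := by
          ext z; simp only [mem_erase, mem_insert, mem_singleton]; grind
        rw [e, zz_tri hab hbd had]; norm_num
      · have e : ({a, b, c, y} : Finset V).erase y = {a, b, c} := by
          ext z; simp only [mem_erase, mem_insert, mem_singleton]; grind
        rw [e, zz_tri hab hbc hac]; norm_num
    norm_num at h1
    linarith

lemma tri_unique (hpos : ∀ S, 0 < zz G (-1/4 : ℝ) S) (h13 : ∀ C, Clo G C → zz G (2:ℤ) C ≠ 13)
    {v b c d e : V} (hb : G.Adj v b) (hc : G.Adj v c) (hbc : G.Adj b c)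
    (hd : G.Adj v d) (he : G.Adj v e) (hde : G.Adj d e) :
    (d = b ∧ e = c) ∨ (d = c ∧ e = b) := by
  by_contra hcon
  by_cases h1 : d = b
  · subst h1
    exact k4e hpos h13 hb hc hbc he hde (by rintro rfl; tauto)
  by_cases h2 : d = c
  · subst h2
    exact k4e hpos h13 hc hb hbc.symm he hde (by rintro rfl; tauto)
  by_cases h3 : e = b
  · subst h3
    exact k4e hpos h13 hb hc hbc hd hde.symm (by rintro rfl; tauto)
  by_cases h4 : e = c
  · subst h4
    exact k4e hpos h13 hc hb hbc.symm hd hde.symm (by rintro rfl; tauto)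
  have n1 := hd.ne
  have n2 := he.ne
  exact tight_two hpos (tight_tri hb hbc hc) (d := d) (e := e) (by simp [*, n1.symm])
    (by simp [*, n2.symm]) hd he hde

end Work

set_option linter.unusedSectionVars false

section Work
open scoped Classical
open Finset
variable {V : Type*} [Fintype V] {G : SimpleGraph V}

/-- standing assumptions -/
structure Nice (G : SimpleGraph V) : Prop where
  pos : ∀ S, 0 < zz G (-1/4 : ℝ) S
  h13 : ∀ C, Clo G C → zz G (2:ℤ) C ≠ 13
  path : ∀ C, Clo G C → ∀ k, 3 ≤ k → zz G (2:ℤ) C ≠ ff 2 k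
  deg0 : ∀ v, G.degree v ≠ 0

/-- degree defect -/
noncomputable def dl (G : SimpleGraph V) (C : Finset V) : ℤ := ∑ v ∈ C, ((G.degree v : ℤ) - 2)

lemma Tail.cardU {S : Finset V} {v : V} {l : List V} (h : Tail G S v l) :
    (S ∪ l.toFinset).card = S.card + l.length := by
  rw [card_union_of_disjoint, List.toFinset_card_of_nodup h.nodup]
  rw [disjoint_right]
  intro a ha
  exact h.disj a (by simpa using ha)

lemma Tail.dl2 {S : Finset V} {v : V} {l : List V} (h : Tail G S v l)
    (h2 : ∀ a ∈ l, G.degree a = 2) : dl G (S ∪ l.toFinset) = dl G S := by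
  unfold dl
  rw [sum_union]
  · rw [sum_eq_zero (s := l.toFinset), add_zero]
    intro a ha
    rw [h2 a (by simpa using ha)]; norm_num
  · rw [disjoint_right]
    intro a ha
    exact h.disj a (by simpa using ha)

lemma Tail.dl1 {S : Finset V} {v t : V} {l : List V} (h : Tail G S v (t :: l))
    (h1 : G.degree t = 1) (h2 : ∀ a ∈ l, G.degree a = 2) :
    dl G (S ∪ (t :: l).toFinset) = dl G S - 1 := by
  rw [← h.of_cons.dl2 h2]
  cases h with
  | cons _ _ g1 g2 g3 g4 =>
    rw [List.toFinset_cons, union_insert]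
    unfold dl
    rw [sum_insert (by simp [g2, g3]), h1]
    norm_num; ring

lemma Tail.sub {S U : Finset V} {v : V} {l : List V} (h : Tail G S v l) (hv : v ∈ S)
    (hU : Clo G U) (hvU : v ∈ U) : (∀ a ∈ l, a ∈ U) ∧ l.headD v ∈ U := by
  induction h with
  | nil => simpa using hvU
  | cons t l h1 h2 h3 h4 ih =>
    have ht : t ∈ U := hU _ ih.2 t ((h4 _ (h1.headD_mem hv)).2 rfl).symm
    simpa using ⟨⟨ht, ih.1⟩, ht⟩

lemma Tail.chain {S : Finset V} {v : V} {l : List V} (h : Tail G S v l) (hv : v ∈ S) :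
    List.IsChain G.Adj (l ++ [v]) := by
  induction h with
  | nil => simp
  | cons t l h1 h2 h3 h4 ih =>
    have ht : G.Adj t (l.headD v) := (h4 _ (h1.headD_mem hv)).2 rfl
    cases l with
    | nil => simpa using ht
    | cons s l => 
      simp only [List.cons_append, List.isChain_cons_cons]
      exact ⟨by simpa using ht, by simpa using ih⟩

/-- a component which looks like a cycle or a `D` -/
def Comp (G : SimpleGraph V) (C : Finset V) : Prop :=
  Clo G C ∧ C.Nonempty ∧ (∀ (R : Type) [CommRing R] (x : R), zz G x C = ll x C.card) ∧
  dl G C = 0 ∧ ∃ L : List V, L.Nodup ∧ L.toFinset = C ∧ L.IsChain G.Adj ∧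
    ((∃ a b M, L = a :: (M ++ [b]) ∧ M ≠ [] ∧ G.Adj a b) ∨
     (∃ a b c M, L = a :: b :: c :: M ∧ G.Adj a c))

lemma zz_close {R : Type*} [CommRing R] {x : R} {S : Finset V} {v t u a : V} {l : List V}
    (h : Tail G S v (t :: l)) (hu : ¬ (u ∈ S ∨ u ∈ t :: l)) (ha : a ∈ S)
    (hn : ∀ b, (b ∈ S ∨ b ∈ t :: l) → (G.Adj u b ↔ b = t ∨ b = a)) :
    zz G x (insert u (S ∪ (t :: l).toFinset)) = zz G x (S ∪ (t :: l).toFinset) +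
      x * zz G x (S.erase a ∪ l.toFinset) := by
  rw [zz_insert (by simp only [mem_union, List.mem_toFinset]; exact hu)]
  congr 3
  have hd := h.disj
  have hnd := h.nodup
  ext b
  have := hn b
  have e1 := hd b
  have e2 := hd t
  simp only [mem_filter, mem_union, List.mem_toFinset, mem_erase, List.mem_cons, List.nodup_cons] at *
  by_cases hb : b = t
  · subst hb; grind
  · by_cases hb' : b = a
    · subst hb'; grind
    · tauto

lemma cycle_comp {U : Finset V} (hU : Clo G U) (h2 : ∀ a ∈ U, G.degree a = 2) {p : V}
    (hp : p ∈ U) : ∃ C, Comp G C ∧ C ⊆ U := by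
  obtain ⟨u1, hu1⟩ := (G.degree_pos_iff_exists_adj p).1 (by rw [h2 p hp]; norm_num)
  obtain ⟨u2, hne, hn⟩ := deg_two (h2 p hp) hu1
  have hu2 : G.Adj p u2 := (hn u2).2 (Or.inr rfl)
  obtain ⟨l, hT, h⟩ := grow (G := G) (fun a b => a = p ∧ b = u2) (S := {p}) (v := p) (u₀ := u1) 
    (by simp) (by simpa using hu1.ne') hu1 (by
      intro a ha b hb hab
      rw [mem_singleton] at ha
      subst ha
      rcases (hn b).1 hab with h | h
      · exact Or.inl ⟨rfl, h⟩
      · exact Or.inr ⟨rfl, h⟩)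
  have hs := hT.sub (by simp) hU hp
  rcases h with ⟨t, l', rfl, h1, -⟩ | ⟨u, hu, hadj, h0, hl, hleave, h⟩
  · have := h2 t (hs.1 t (by simp)); omega
  rcases h with ⟨a, ha, hE, hau, hah, hdu⟩ | h
  swap
  · have := h2 u (hU _ hs.2 u hadj); omega
  rw [mem_singleton] at ha
  subst ha
  obtain ⟨-, rfl⟩ := hE
  cases l with
  | nil => simp at hah
  | cons t l =>
    simp only [List.headD_cons] at hadj hleave hah
    have hnu := deg_two' hdu hadj.symm hau.symm hah.symm
    have hz : ∀ (R : Type) [CommRing R] (x : R), zz G x (insert u ({a} ∪ (t :: l).toFinset)) =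
        ll x (l.length + 3) := by
      intro R _ x
      rw [zz_close hT hu (mem_singleton_self a) (fun b _ => hnu b), zz_tail hT subset_rfl,
        zz_tail hT.of_cons (erase_subset _ _), ll_eq_ff]
      simp [zz_single, zz_empty, ff]
      ring
    have hc : (insert u ({a} ∪ (t :: l).toFinset)).card = l.length + 3 := by
      rw [card_insert_of_notMem (by simp only [mem_union, List.mem_toFinset]; exact hu), hT.cardU]; simp; ring
    have hsub : insert u ({a} ∪ (t :: l).toFinset) ⊆ U := by
      intro b hb
      simp only [mem_insert, mem_union, mem_singleton, List.mem_toFinset] at hb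
      rcases hb with rfl | rfl | hb
      · exact hU _ hp _ hau
      · exact hp
      · exact hs.1 b hb
    refine ⟨insert u ({a} ∪ (t :: l).toFinset), ⟨?_, ⟨u, by simp⟩, ?_, ?_, ?_⟩, hsub⟩
    · intro b hb d hbd
      by_contra hd
      simp only [mem_insert, mem_union, List.mem_toFinset, not_or] at hb hd
      by_cases hbu : b = u
      · subst hbu
        rcases (hnu d).1 hbd with rfl | rfl
        · simp at hd
        · simp at hd
      · have := hleave b (by tauto) d (by tauto) hbd
        tauto
    · intro R _ x
      rw [hc, hz]
    · unfold dl
      apply sum_eq_zero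
      intro b hb
      rw [h2 b (hsub hb)]; norm_num
    · refine ⟨u :: ((t :: l) ++ [a]), ?_, ?_, ?_, Or.inl ⟨u, a, t :: l, rfl, by simp, hau.symm⟩⟩
      · rw [List.nodup_cons, List.nodup_append]
        refine ⟨?_, hT.nodup, by simp, ?_⟩
        · simp only [List.mem_append, List.mem_singleton]
          rw [mem_singleton] at hu
          tauto
        · intro b hb c hc
          simp only [List.mem_singleton] at hc
          subst hc
          rintro rfl
          exact hT.disj _ hb (by simp)
      · ext b; simp [or_comm, or_left_comm]
      · have := hT.chain (mem_singleton_self a)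
        rw [List.cons_append] at this ⊢
        exact List.isChain_cons_cons.2 ⟨hadj.symm, this⟩

lemma leaf_hit (hN : Nice G) {p : V} (hp : G.degree p = 1) : 
    ∃ l u, Tail G {p} p l ∧ ¬ (u ∈ ({p} : Finset V) ∨ u ∈ l) ∧ G.Adj (l.headD p) u ∧
      (∀ a ∈ l, G.degree a = 2) ∧ 
      (∀ a, (a ∈ ({p} : Finset V) ∨ a ∈ l) → ∀ b, ¬ (b ∈ ({p} : Finset V) ∨ b ∈ l) → G.Adj a b →
          (a = l.headD p ∧ b = u)) ∧ 3 ≤ G.degree u := by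
  obtain ⟨u1, hu1⟩ := (G.degree_pos_iff_exists_adj p).1 (by rw [hp]; norm_num)
  have hn := deg_one hp hu1
  obtain ⟨l, hT, h⟩ := grow (G := G) (fun a b => False) (S := {p}) (v := p) (u₀ := u1) 
    (by simp) (by simpa using hu1.ne') hu1 (by
      intro a ha b hb hab
      rw [mem_singleton] at ha
      subst ha
      exact Or.inl ⟨rfl, (hn b).1 hab⟩)
  rcases h with ⟨t, l', rfl, h1, -, hleave⟩ | ⟨u, hu, hadj, h0, hl, hleave, h⟩
  · exfalso
    refine hN.path ({p} ∪ (t :: l').toFinset) ?_ (l'.length + 4) (by omega) ?_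
    · intro a ha b hab
      by_contra hb
      simp only [mem_union, List.mem_toFinset] at ha hb
      exact (hleave a ha b hb hab).2
    · rw [zz_tail hT subset_rfl]
      simp [zz_single, zz_empty, ff]; ring
  · refine ⟨l, u, hT, hu, hadj, hl, ?_, ?_⟩
    · intro a ha b hb hab
      have := hleave a ha b hb hab
      tauto
    · rcases h with ⟨a, h1, h2, -⟩ | h
      · exact h2.elim
      · exact h

lemma hit_tri (hN : Nice G) {S : Finset V} {v : V} (h : Tight G S v)
    {l : List V} (hl : Tail G S v l) {u b c : V} (hu : ¬ (u ∈ S ∨ u ∈ l))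
    (hvu : G.Adj (l.headD v) u) (hub : G.Adj u b) (huc : G.Adj u c) (hbc : G.Adj b c)
    (hleave : ∀ a, (a ∈ S ∨ a ∈ l) → ∀ b, ¬ (b ∈ S ∨ b ∈ l) → G.Adj a b →
          (a = l.headD v ∧ b = u)) : False := by
  by_cases hb : b ∈ S ∨ b ∈ l
  · have h1 := (hleave b hb u hu hub.symm).1
    by_cases hc : c ∈ S ∨ c ∈ l
    · have h2 := (hleave c hc u hu huc.symm).1
      exact hbc.ne (h1.trans h2.symm)
    · exact huc.ne (hleave b hb c hc hbc).2.symm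
  · by_cases hc : c ∈ S ∨ c ∈ l
    · exact hub.ne (hleave c hc b hb hbc.symm).2.symm
    · exact tight_hit hN.pos h hl hu hvu hb hc hub huc hbc

lemma tri_comp {q y z : V} (hq : G.degree q = 3) (hy : G.degree y = 2) (hz : G.degree z = 2)
    (hqy : G.Adj q y) (hqz : G.Adj q z) (hyz : G.Adj y z) :
    (∃ C, Comp G C ∧ q ∈ C ∧ (∀ U, Clo G U → q ∈ U → C ⊆ U) ∧ (∀ a ∈ C, a = q ∨ G.degree a ≤ 2)) ∨
    ∃ l u, Tail G {q, y, z} q l ∧ ¬ (u ∈ ({q, y, z} : Finset V) ∨ u ∈ l) ∧ G.Adj (l.headD q) u ∧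
      (∀ a ∈ l, G.degree a = 2) ∧ 
      (∀ a, (a ∈ ({q, y, z} : Finset V) ∨ a ∈ l) → ∀ b, ¬ (b ∈ ({q, y, z} : Finset V) ∨ b ∈ l) → 
        G.Adj a b → (a = l.headD q ∧ b = u)) ∧ 3 ≤ G.degree u := by
  obtain ⟨r, hr1, hr2, hn⟩ := deg_three hq hqy hqz hyz.ne
  have hqr : G.Adj q r := (hn r).2 (by simp)
  have ny := deg_two' hy hqy.symm hyz hqz.ne
  have nz := deg_two' hz hqz.symm hyz.symm hqy.ne
  obtain ⟨l, hT, h⟩ := grow (G := G) (fun a b => False) (S := {q, y, z}) (v := q) (u₀ := r) 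
    (by simp) (by simp [hqr.ne', hr1, hr2]) hqr (by
      intro a ha b hb hab
      simp only [mem_insert, mem_singleton, not_or] at ha hb
      rcases ha with rfl | rfl | rfl
      · have := (hn b).1 hab; tauto
      · have := (ny b).1 hab; tauto
      · have := (nz b).1 hab; tauto)
  rcases h with ⟨t, l', rfl, h1, h2, hleave⟩ | ⟨u, hu, hadj, h0, hl, hleave, h⟩
  · left
    have hcl : Clo G ({q, y, z} ∪ (t :: l').toFinset) := by
      intro a ha b hab
      by_contra hb
      simp only [mem_union, List.mem_toFinset] at ha hb
      exact (hleave a ha b hb hab).2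
    have hc3 : ({q, y, z} : Finset V).card = 3 := card_eq_three.2 ⟨_, _, _, hqy.ne, hqz.ne, hyz.ne, rfl⟩
    refine ⟨{q, y, z} ∪ (t :: l').toFinset, ⟨hcl, ⟨q, by simp⟩, ?_, ?_, ?_⟩, by simp, ?_, ?_⟩
    · intro R _ x
      rw [hT.cardU, hc3, zz_tail hT subset_rfl, erase_insert (by simp [hqy.ne, hqz.ne]),
        zz_tri hqy hyz hqz, zz_pair hyz, List.length_cons, 
        show 3 + (l'.length + 1) = (l'.length + 3) + 1 by ring, ll_eq_ff]
      simp only [ff]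
      ring
    · rw [hT.dl1 h1 h2]
      unfold dl
      rw [sum_insert (by simp [hqy.ne, hqz.ne]), sum_insert (by simp [hyz.ne]), sum_singleton, hq, hy, hz]
      norm_num
    · refine ⟨((t :: l') ++ [q, z, y]).reverse, ?_, ?_, ?_, ?_⟩
      · rw [List.nodup_reverse, List.nodup_append]
        refine ⟨hT.nodup, by simp [hqy.ne, hqz.ne, hyz.ne'], ?_⟩
        rintro b hb c hc rfl
        refine hT.disj _ hb ?_
        simp at hc ⊢; tauto
      · ext b; simp; tauto
      · rw [List.isChain_reverse]
        have h3 := hT.chain (by simp)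
        rw [show (t :: l') ++ [q, z, y] = ((t :: l') ++ [q]) ++ [z, y] by simp]
        have h4 : List.IsChain (fun a b => G.Adj b a) ((t :: l') ++ [q]) := 
          h3.imp (fun a b h => G.adj_symm h)
        refine List.IsChain.append h4 (by simpa using hyz) ?_
        intro a ha b hb
        rw [List.getLast?_append] at ha
        simp at ha hb
        subst ha hb
        exact hqz.symm
      · right
        refine ⟨y, z, q, (t :: l').reverse, by simp, hqy.symm⟩
    · intro U hU hqU b hb
      simp only [mem_insert, mem_union, mem_singleton, List.mem_toFinset] at hb
      have hs := hT.sub (by simp) hU hqU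
      rcases hb with (rfl | rfl | rfl) | hb
      · exact hqU
      · exact hU _ hqU _ hqy
      · exact hU _ hqU _ hqz
      · exact hs.1 b hb
    · intro b hb
      simp only [mem_insert, mem_union, mem_singleton, List.mem_toFinset, List.mem_cons] at hb
      rcases hb with (rfl | rfl | rfl) | rfl | hb
      · simp
      · right; omega
      · right; omega
      · right; omega
      · right; rw [h2 b hb]
  · right
    refine ⟨l, u, hT, hu, hadj, hl, ?_, ?_⟩
    · intro a ha b hb hab
      have := hleave a ha b hb hab
      tauto
    · rcases h with ⟨a, h1, h2, -⟩ | h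
      · exact h2.elim
      · exact h

/-- the local condition -/
def StarC (G : SimpleGraph V) (U : Finset V) : Prop := ∀ v ∈ U, G.degree v = 1 ∨ G.degree v = 2 ∨
  (G.degree v = 3 ∧ ∃ y z, G.Adj v y ∧ G.Adj v z ∧ G.Adj y z ∧ G.degree y = 2 ∧ G.degree z = 2)

lemma peel (hN : Nice G) {U : Finset V} (hU : Clo G U) (hs : StarC G U) (hne : U.Nonempty) :
    ∃ C, Comp G C ∧ C ⊆ U := by
  by_cases h3 : ∃ q ∈ U, G.degree q = 3
  · obtain ⟨q, hqU, hq⟩ := h3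
    rcases hs q hqU with h | h | ⟨-, y, z, hqy, hqz, hyz, hy, hz⟩
    · omega
    · omega
    rcases tri_comp hq hy hz hqy hqz hyz with ⟨C, hC, -, hCU, -⟩ | 
      ⟨l, u, hT, hu, hadj, hl, hleave, hdu⟩
    · exact ⟨C, hC, hCU U hU hqU⟩
    · exfalso
      have huU : u ∈ U := hU _ (hT.sub (by simp) hU hqU).2 u hadj
      rcases hs u huU with h | h | ⟨-, b, c, hub, huc, hbc, -, -⟩
      · omega
      · omega
      exact hit_tri hN (tight_tri hqy hyz hqz) hT hu hadj hub huc hbc hleave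
  · push Not at h3
    have h3' : ∀ q ∈ U, G.degree q = 1 ∨ G.degree q = 2 := by
      intro q hq
      have := hs q hq
      have := h3 q hq
      tauto
    by_cases h1 : ∃ p ∈ U, G.degree p = 1
    · exfalso
      obtain ⟨p, hpU, hp⟩ := h1
      obtain ⟨l, u, hT, hu, hadj, -, -, hd⟩ := leaf_hit hN hp
      have := h3' u (hU _ (hT.sub (by simp) hU hpU).2 u hadj)
      omega
    · push Not at h1
      obtain ⟨p, hp⟩ := hne
      exact cycle_comp hU (fun a ha => by have := h3' a ha; have := h1 a ha; tauto) hp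

/-- weight at `-1/4` -/
noncomputable def ww (G : SimpleGraph V) (U : Finset V) : ℝ := 2 ^ U.card * zz G (-1/4 : ℝ) U

lemma ww_clo {C U : Finset V} (hC : Clo G C) (h : C ⊆ U) : ww G U = ww G C * ww G (U \ C) := by
  unfold ww
  rw [zz_clo hC h, ← card_sdiff_add_card_eq_card h, pow_add]
  ring

lemma dl_clo {C U : Finset V} (h : C ⊆ U) : dl G U = dl G C + dl G (U \ C) := by
  unfold dl
  rw [← sum_sdiff h, add_comm]

lemma peel_all (hN : Nice G) {U : Finset V} (hU : Clo G U) (hs : StarC G U) :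
    ∃ j : ℕ, ww G U = 2 ^ j ∧ dl G U = 0 ∧ (j = 0 → U = ∅) ∧ (j = 1 → Comp G U) := by
  induction hk : U.card using Nat.strong_induction_on generalizing U with
  | _ k ih =>
    rcases U.eq_empty_or_nonempty with rfl | hne
    · exact ⟨0, by simp [ww, zz_empty], by simp [dl], by simp, by simp⟩
    obtain ⟨C, hC, hCU⟩ := peel hN hU hs hne
    have hC' := hC
    obtain ⟨hcl, hCne, hz, hd, -⟩ := hC'
    have hcard := card_sdiff_add_card_eq_card hCU
    have hCpos := hCne.card_pos
    obtain ⟨j, h1, h2, h3, h4⟩ := ih (U \ C).card (by omega) (hU.sdiff hcl)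
      (fun v hv => hs v (mem_sdiff.1 hv).1) rfl
    refine ⟨j + 1, ?_, ?_, by simp, ?_⟩
    · rw [ww_clo hcl hCU, h1, ww, hz ℝ, ll_quarter]; ring
    · rw [dl_clo hCU, hd, h2]; rfl
    · intro hj
      have := h3 (by omega)
      rw [sdiff_eq_empty_iff_subset] at this
      rw [subset_antisymm this hCU]
      exact hC

end Work

section Work
open scoped Classical
open Finset

lemma fin_sub_val {n : ℕ} (u v : Fin n) :
    ((u - v : Fin n) : ℕ) = if (v:ℕ) ≤ u then (u:ℕ) - v else n + u - v := by
  have h1 := u.isLt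
  have h2 := v.isLt
  rw [Fin.sub_def]
  simp only
  split_ifs with h
  · rw [show n - (v:ℕ) + u = (u - v) + n by omega, Nat.add_mod_right, Nat.mod_eq_of_lt (by omega)]
  · rw [Nat.mod_eq_of_lt (by omega)]; omega

lemma cyc_adj {n : ℕ} (hn : 4 ≤ n) (u v : Fin n) : (cycleGraph n).Adj u v ↔
    u ≠ v ∧ ((u.val + 1 = v.val ∨ (u.val = 0 ∧ v.val = n - 1)) ∨
      (v.val + 1 = u.val ∨ (v.val = 0 ∧ u.val = n - 1))) := by
  rw [cycleGraph_adj', fin_sub_val, fin_sub_val, ne_eq, Fin.ext_iff]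
  have h1 := u.isLt
  have h2 := v.isLt
  split_ifs <;> omega

lemma cyc_tri {n : ℕ} (hn : 4 ≤ n) {u v w : Fin n} (h1 : (cycleGraph n).Adj u v)
    (h2 : (cycleGraph n).Adj u w) (h3 : (cycleGraph n).Adj v w) : False := by
  rw [cyc_adj hn, ne_eq, Fin.ext_iff] at h1 h2 h3
  omega

lemma cyc_deg {n : ℕ} (hn : 4 ≤ n) (u : Fin n) : (cycleGraph n).degree u = 2 := by
  obtain ⟨m, rfl⟩ : ∃ m, n = m + 3 := ⟨n - 3, by omega⟩
  convert cycleGraph_degree_three_le (n := m) (v := u)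

lemma clo_conn {V : Type*} [Fintype V] {G : SimpleGraph V} (hG : G.Preconnected) {C : Finset V}
    (hC : Clo G C) (hne : C.Nonempty) : C = univ := by
  obtain ⟨a, ha⟩ := hne
  ext b
  simp only [mem_univ, iff_true]
  obtain ⟨p⟩ := hG a b
  induction p with
  | nil => exact ha
  | cons h p ih => exact ih (hC _ ha _ h)

lemma cyc_zz {n : ℕ} (hn : 4 ≤ n) (R : Type) [CommRing R] (x : R) :
    zz (cycleGraph n) x univ = ll x n := by
  obtain ⟨C, hC, -⟩ := cycle_comp (G := cycleGraph n) (U := univ) (fun _ _ _ _ => mem_univ _)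
    (fun a _ => by convert cyc_deg hn a) (p := ⟨0, by omega⟩) (mem_univ _)
  have h2 := clo_conn cycleGraph_preconnected hC.1 hC.2.1
  have := hC.2.2.1 R x
  rw [h2] at this
  simpa using this

lemma iso_of {V : Type*} [Fintype V] {G : SimpleGraph V} {n : ℕ} (K : SimpleGraph (Fin n)) 
    (f : Fin n → V)
    (hf : Function.Bijective f) (hom : ∀ i j, K.Adj i j → G.Adj (f i) (f j))
    (hK : n ≤ K.edgeFinset.card) (hG : G.edgeFinset.card ≤ n) : Nonempty (G ≃g K) := by
  have hinj : Function.Injective (Sym2.map f) := Sym2.map.injective hf.1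
  have hsub : K.edgeFinset.image (Sym2.map f) ⊆ G.edgeFinset := by
    intro e he
    obtain ⟨d, hd, rfl⟩ := mem_image.1 he
    induction d using Sym2.ind with
    | _ i j =>
      rw [mem_edgeFinset, mem_edgeSet] at hd
      rw [mem_edgeFinset, Sym2.map_mk, mem_edgeSet]
      exact hom i j hd
  have heq := eq_of_subset_of_card_le hsub (by rw [card_image_of_injective _ hinj]; omega)
  refine ⟨(RelIso.mk (Equiv.ofBijective f hf) ?_ : K ≃g G).symm⟩
  intro i j
  constructor
  · intro h
    have : s(f i, f j) ∈ G.edgeFinset := by rw [mem_edgeFinset]; exact h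
    rw [← heq] at this
    obtain ⟨d, hd, he⟩ := mem_image.1 this
    have : d = s(i, j) := hinj (by rw [he, Sym2.map_mk])
    rw [this, mem_edgeFinset] at hd
    exact hd
  · exact hom i j

lemma edge_count {n c : ℕ} (hc : 2 ≤ c) (hcn : c < n) (K : SimpleGraph (Fin n))
    (h1 : ∀ i j : Fin n, i.val + 1 = j.val → K.Adj i j)
    (h2 : ∀ i j : Fin n, i.val = 0 → j.val = c → K.Adj i j) : n ≤ K.edgeFinset.card := by
  let e : Fin n → Sym2 (Fin n) := fun i => if h : i.val + 1 < n then s(i, ⟨i.val + 1, h⟩) else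
    s(⟨0, by omega⟩, ⟨c, hcn⟩)
  have he : Function.Injective e := by
    intro i j hij
    have hi := i.isLt
    have hj := j.isLt
    simp only [e] at hij
    split_ifs at hij <;> simp only [Sym2.eq_iff, Fin.ext_iff] at hij <;> ext <;> omega
  have := card_le_card_of_injOn (s := (univ : Finset (Fin n))) (t := K.edgeFinset) e (by
    intro i _
    rw [mem_coe, mem_edgeFinset]
    simp only [e]
    split_ifs with h
    · exact h1 _ _ rfl
    · exact h2 _ _ rfl rfl) he.injOn
  simpa using this

lemma comp_iso {V : Type*} [Fintype V] {G : SimpleGraph V} {n : ℕ} (hn : 4 ≤ n) 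
    (hV : Fintype.card V = n) (h : Comp G univ) :
    Nonempty (G ≃g cycleGraph n) ∨ Nonempty (G ≃g Dgraph n) := by
  obtain ⟨-, -, -, hd, L, hnd, hL, hch, h⟩ := h
  have hlen : L.length = n := by
    rw [← List.toFinset_card_of_nodup hnd, hL, card_univ, hV]
  have hE : G.edgeFinset.card ≤ n := by
    have := G.sum_degrees_eq_twice_card_edges
    unfold dl at hd
    rw [sum_sub_distrib] at hd
    simp only [sum_const, card_univ, hV] at hd
    rw [← Nat.cast_sum, this] at hd
    push_cast at hd
    simp at hd
    omega
  let f : Fin n → V := fun i => L[i.val]'(by rw [hlen]; exact i.isLt)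
  have hfi : Function.Injective f := by
    intro i j hij
    exact Fin.ext ((hnd.getElem_inj_iff).1 hij)
  have hf : Function.Bijective f := by
    rw [Fintype.bijective_iff_injective_and_card]
    exact ⟨hfi, by simp [hV]⟩
  rw [List.isChain_iff_getElem] at hch
  have hstep : ∀ i j : Fin n, i.val + 1 = j.val → G.Adj (f i) (f j) := by
    intro i j hij
    have := hch i.val (by have := j.isLt; omega)
    simp only [f]
    convert this using 2
    omega
  rcases h with ⟨a, b, M, rfl, hM, hab⟩ | ⟨a, b, c, M, rfl, hac⟩
  · left
    have hc : ∀ i j : Fin n, i.val = 0 → j.val = n - 1 → G.Adj (f i) (f j) := by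
      intro i j hi hj
      simp only [List.length_cons, List.length_append, List.length_nil] at hlen
      have hj' : j.val = M.length + 1 := by omega
      simp only [f, hi, hj']
      simpa using hab
    apply iso_of (cycleGraph n) f hf _ _ hE
    · intro i j hij
      rw [cyc_adj hn] at hij
      rcases hij.2 with (h | h) | (h | h)
      · exact hstep _ _ h
      · exact hc _ _ h.1 h.2
      · exact (hstep _ _ h).symm
      · exact (hc _ _ h.1 h.2).symm
    · apply edge_count (c := n - 1) (by omega) (by omega)
      · intro i j h
        rw [cyc_adj hn, ne_eq, Fin.ext_iff]; omega
      · intro i j h h'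
        rw [cyc_adj hn, ne_eq, Fin.ext_iff]; omega
  · right
    have hc : ∀ i j : Fin n, i.val = 0 → j.val = 2 → G.Adj (f i) (f j) := by
      intro i j hi hj
      simp only [f, hi, hj]
      simpa using hac
    apply iso_of (Dgraph n) f hf _ _ hE
    · intro i j hij
      rw [Dgraph, fromRel_adj] at hij
      rcases hij.2 with (h | h) | (h | h)
      · exact hstep _ _ h
      · exact hc _ _ h.1 h.2
      · exact (hstep _ _ h).symm
      · exact (hc _ _ h.1 h.2).symm
    · apply edge_count (c := 2) (by omega) (by omega)
      · intro i j h
        rw [Dgraph, fromRel_adj, ne_eq, Fin.ext_iff]; omega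
      · intro i j h h'
        rw [Dgraph, fromRel_adj, ne_eq, Fin.ext_iff]; omega

variable {V : Type*} [Fintype V] (G : SimpleGraph V)

/-- number of independent sets of size `k` in `S` -/
noncomputable def cc (S : Finset V) (k : ℕ) : ℕ :=
  (S.powerset.filter (fun s => G.IsIndepFinset s ∧ s.card = k)).card

lemma cc_coeff (k : ℕ) : G.indepPoly.coeff k = cc G univ k := by
  unfold SimpleGraph.indepPoly cc
  rw [Polynomial.finsetSum_coeff, powerset_univ, card_filter, Nat.cast_sum]
  apply sum_congr rfl
  intro s _
  by_cases h : G.IsIndepFinset s <;> simp [h, Polynomial.coeff_X_pow, eq_comm]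

lemma cc_zero (S : Finset V) : cc G S 0 = 1 := by
  unfold cc
  rw [card_eq_one]
  refine ⟨∅, ?_⟩
  ext s
  simp only [mem_filter, mem_powerset, card_eq_zero, mem_singleton]
  constructor
  · exact fun h => h.2.2
  · rintro rfl
    simp [SimpleGraph.IsIndepFinset]

lemma cc_succ (S : Finset V) (k : ℕ) :
    (k + 1) * cc G S (k + 1) = ∑ v ∈ S, cc G (S.filter (fun u => u ≠ v ∧ ¬ G.Adj v u)) k := by
  have h := sum_card_bipartiteAbove_eq_sum_card_bipartiteBelow (fun (v : V) (s : Finset V) => v ∈ s)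
    (s := S) (t := S.powerset.filter (fun s => G.IsIndepFinset s ∧ s.card = k + 1))
  have h2 : ∑ s ∈ S.powerset.filter (fun s => G.IsIndepFinset s ∧ s.card = k + 1),
      (bipartiteBelow (fun (v : V) (s : Finset V) => v ∈ s) S s).card = 
      cc G S (k+1) * (k + 1) := by
    unfold cc
    apply sum_const_nat
    intro s hs
    simp only [mem_filter, mem_powerset] at hs
    rw [← hs.2.2]
    congr 1
    ext v
    simp only [bipartiteBelow, mem_filter]
    exact ⟨fun h => h.2, fun h => ⟨hs.1 h, h⟩⟩
  rw [mul_comm, ← h2, ← h]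
  apply sum_congr rfl
  intro v hv
  unfold cc
  refine card_bij' (fun s _ => s.erase v) (fun s _ => insert v s) ?_ ?_ ?_ ?_
  · intro s hs
    simp only [bipartiteAbove, mem_filter, mem_powerset] at hs ⊢
    obtain ⟨⟨h1, h3, h4⟩, h5⟩ := hs
    refine ⟨?_, ?_, ?_⟩
    · intro u hu
      rw [mem_erase] at hu
      exact mem_filter.2 ⟨h1 hu.2, hu.1, h3 v h5 u hu.2⟩
    · intro a ha b hb
      exact h3 a (mem_of_mem_erase ha) b (mem_of_mem_erase hb)
    · rw [card_erase_of_mem h5, h4]; rfl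
  · intro s hs
    simp only [bipartiteAbove, mem_filter, mem_powerset] at hs ⊢
    obtain ⟨h1, h3, h4⟩ := hs
    have hvs : v ∉ s := fun h => (mem_filter.1 (h1 h)).2.1 rfl
    refine ⟨⟨?_, ?_, ?_⟩, by simp⟩
    · intro u hu
      rcases mem_insert.1 hu with rfl | hu
      · exact hv
      · exact (mem_filter.1 (h1 hu)).1
    · exact indep_insert.2 ⟨h3, fun w hw => (mem_filter.1 (h1 hw)).2.2⟩
    · rw [card_insert_of_notMem hvs, h4]
  · intro s hs
    simp only [bipartiteAbove, mem_filter] at hs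
    exact insert_erase hs.2
  · intro s hs
    simp only [mem_filter, mem_powerset] at hs
    exact erase_insert (fun h => (mem_filter.1 (hs.1 h)).2.1 rfl)

lemma cc_one (S : Finset V) : cc G S 1 = S.card := by
  have := cc_succ G S 0
  simpa [cc_zero] using this

/-- adjacency indicator -/
noncomputable def aa (v w : V) : ℤ := if G.Adj v w then 1 else 0

/-- non-adjacency indicator -/
noncomputable def bb (v w : V) : ℤ := if w ≠ v ∧ ¬ G.Adj v w then 1 else 0

lemma bb_eq (v w : V) : bb G v w = 1 - (if v = w then 1 else 0) - aa G v w := by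
  unfold bb aa
  by_cases h : v = w
  · subst h; simp
  · by_cases h2 : G.Adj v w <;> simp [h, h2, Ne.symm h]

lemma sum_aa (v : V) : ∑ w, aa G v w = G.degree v := by
  unfold aa
  rw [← card_neighborFinset_eq_degree, neighborFinset_eq_filter, card_filter]
  push_cast
  rfl

lemma aa_comm (v w : V) : aa G v w = aa G w v := by
  unfold aa; rw [G.adj_comm]

lemma sum_bb (v : V) : ∑ w, bb G v w = Fintype.card V - 1 - G.degree v := by
  simp only [bb_eq, sum_sub_distrib, sum_aa]
  simp

lemma cc_two' (S : Finset V) : 2 * (cc G S 2 : ℤ) = ∑ v ∈ S, ∑ w ∈ S, bb G v w := by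
  have := cc_succ G S 1
  simp only [cc_one] at this
  zify at this
  norm_num at this
  rw [this]
  apply sum_congr rfl
  intro v _
  rw [card_filter]; push_cast; rfl

lemma cc_two : 2 * (cc G univ 2 : ℤ) = ∑ v, ((Fintype.card V : ℤ) - 1 - G.degree v) := by
  rw [cc_two']
  simp only [sum_bb]

lemma cc_three' : 6 * (cc G univ 3 : ℤ) = ∑ v, ∑ w, ∑ u, bb G v w * (bb G v u * bb G w u) := by
  have := cc_succ G univ 2
  zify at this
  norm_num at this
  rw [show (6:ℤ) = 2 * 3 by norm_num, mul_assoc, this, mul_sum]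
  apply sum_congr rfl
  intro v _
  rw [cc_two', sum_filter]
  apply sum_congr rfl
  intro w _
  rw [sum_filter]
  unfold bb
  split_ifs with h
  · apply sum_congr rfl
    intro u _
    split_ifs <;> simp
  · simp

/-- ordered triangles at `v` -/
noncomputable def tt (v : V) : ℤ := ∑ w, ∑ u, aa G v w * (aa G v u * aa G w u)

lemma sum_bbbb (v w : V) : ∑ u, bb G v u * bb G w u = (Fintype.card V : ℤ) - 2 - G.degree v
    - G.degree w + (if v = w then 1 else 0) + 2 * aa G v w + ∑ u, aa G v u * aa G w u := by
  have : ∀ u, bb G v u * bb G w u = 1 - aa G v u - aa G w u - (if v = u then 1 else 0)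
     - (if w = u then 1 else 0) + (if v = u then 1 else 0) * (if w = u then 1 else 0) +
     (if v = u then 1 else 0) * aa G w u + (if w = u then 1 else 0) * aa G v u + aa G v u * aa G w u := by
    intro u
    rw [bb_eq, bb_eq]; ring
  simp only [this, sum_add_distrib, sum_sub_distrib, sum_aa]
  simp [aa_comm G w v, eq_comm (a := w)]
  ring

lemma cc_three : 6 * (cc G univ 3 : ℤ) = ∑ v, (((Fintype.card V : ℤ) - 1) * (Fintype.card V - 2)
    - (3 * Fintype.card V - 3) * G.degree v + 3 * (G.degree v) ^ 2 - tt G v) := by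
  rw [cc_three']
  set n : ℤ := (Fintype.card V : ℤ) with hn
  have h1 : ∀ v w, ∑ u, bb G v w * (bb G v u * bb G w u) = 
      bb G v w * (n - 2 - G.degree v) - bb G v w * G.degree w + ∑ u, aa G v u * aa G w u
      - (if v = w then ∑ u, aa G v u * aa G w u else 0) - ∑ u, aa G v w * (aa G v u * aa G w u) := by
    intro v w
    rw [← mul_sum, sum_bbbb, ← mul_sum, ← hn]
    by_cases h : v = w
    · subst h; simp [bb_eq, aa]
    · by_cases h2 : G.Adj v w <;> simp [bb_eq, aa, h, h2]
  simp only [h1, sum_sub_distrib, sum_add_distrib]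
  have h2 : ∑ v, ∑ w, bb G v w * (G.degree w : ℤ) = ∑ v, (n - 1 - G.degree v) * G.degree v := by
    rw [sum_comm]
    apply sum_congr rfl
    intro v _
    rw [← sum_mul, ← sum_bb]
    congr 1
    apply sum_congr rfl
    intro w _
    unfold bb; simp [ne_comm, G.adj_comm]
  have h3 : ∑ v, ∑ w, ∑ u, aa G v u * aa G w u = ∑ u, (G.degree u : ℤ) ^ 2 := by
    have : ∀ v, ∑ w, ∑ u, aa G v u * aa G w u = ∑ u, aa G v u * G.degree u := by
      intro v
      rw [sum_comm]
      apply sum_congr rfl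
      intro u _
      rw [← mul_sum, ← sum_aa]
      simp only [aa_comm G u]
    simp only [this]
    rw [sum_comm]
    apply sum_congr rfl
    intro u _
    rw [← sum_mul, sq, ← sum_aa]
    simp only [aa_comm G u]
  have h4 : ∀ v, ∑ w, (if v = w then ∑ u, aa G v u * aa G w u else 0) = (G.degree v : ℤ) := by
    intro v
    simp only [sum_ite_eq, mem_univ, if_true]
    rw [← sum_aa]
    apply sum_congr rfl
    intro u _
    unfold aa; simp
  simp only [h2, h3, h4, ← sum_mul, sum_bb, ← hn]
  simp only [sum_mul, tt, ← sum_sub_distrib, ← sum_add_distrib]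
  apply sum_congr rfl
  intro v _
  ring

end Work

set_option linter.unusedSectionVars false
section Work
open scoped Classical
open Finset

lemma counting {V : Type*} [Fintype V] {G : SimpleGraph V} {n : ℕ} (hn : 4 ≤ n)
    (h : G.indepPoly = (cycleGraph n).indepPoly) :
    Fintype.card V = n ∧ dl G univ = 0 ∧
      3 * ∑ v, ((G.degree v : ℤ) - 2) ^ 2 = ∑ v, tt G v := by
  have hc : ∀ k, cc G univ k = cc (cycleGraph n) univ k := by
    intro k
    have := cc_coeff G k
    rw [h, cc_coeff] at this
    exact_mod_cast this.symm
  have h1 := hc 1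
  rw [cc_one, cc_one, card_univ, card_univ, Fintype.card_fin] at h1
  have hdeg : ∀ u, (cycleGraph n).degree u = 2 := cyc_deg hn
  have htt : ∀ u, tt (cycleGraph n) u = 0 := by
    intro u
    unfold tt
    apply sum_eq_zero
    intro w _
    apply sum_eq_zero
    intro v _
    unfold aa
    by_cases e1 : (cycleGraph n).Adj u w
    · by_cases e2 : (cycleGraph n).Adj u v
      · by_cases e3 : (cycleGraph n).Adj w v
        · exact (cyc_tri hn e1 e2 e3).elim
        · simp [e3]
      · simp [e2]
    · simp [e1]
  have h2 : ∑ v, ((Fintype.card V : ℤ) - 1 - G.degree v) = 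
      ∑ v : Fin n, ((n : ℤ) - 1 - 2) := by
    rw [← cc_two, hc, cc_two]
    simp only [Fintype.card_fin]
    apply sum_congr rfl
    intro v _
    congr 1
    have := hdeg v
    norm_cast
    convert this
  have h3 : ∑ v, (((Fintype.card V : ℤ) - 1) * (Fintype.card V - 2)
    - (3 * Fintype.card V - 3) * G.degree v + 3 * (G.degree v) ^ 2 - tt G v) = 
      ∑ v : Fin n, (((n : ℤ) - 1) * (n - 2) - (3 * n - 3) * 2 + 3 * 2 ^ 2 - 0) := by
    rw [← cc_three, hc, cc_three]
    simp only [Fintype.card_fin]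
    apply sum_congr rfl
    intro v _
    have : ((cycleGraph n).degree v : ℤ) = 2 := by
      have := hdeg v
      norm_cast
    rw [htt]
    have e : ∀ d : ℤ, d = 2 → ((n : ℤ) - 1) * (n - 2) - (3 * n - 3) * d + 3 * d ^ 2 - 0 =
      ((n : ℤ) - 1) * (n - 2) - (3 * n - 3) * 2 + 3 * 2 ^ 2 - 0 := by rintro d rfl; rfl
    apply e
    convert this
  have h4 : ∑ v, (G.degree v : ℤ) = 2 * n := by
    rw [sum_sub_distrib] at h2
    simp [h1] at h2
    linarith
  refine ⟨h1, ?_, ?_⟩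
  · unfold dl
    rw [sum_sub_distrib, h4]
    simp [h1]; ring
  · have h5 : ∑ v, ((G.degree v : ℤ) - 2) ^ 2 = ∑ v, (G.degree v : ℤ)^2 - 4 * (2 * n) + 4 * n := by
      rw [← h4, mul_sum, ← sum_sub_distrib]
      have : (4 * n : ℤ) = ∑ v : V, 4 := by simp [h1]; ring
      rw [this, ← sum_add_distrib]
      apply sum_congr rfl
      intro v _
      ring
    rw [sum_sub_distrib, sum_add_distrib, sum_sub_distrib, ← mul_sum, ← mul_sum, h4] at h3
    simp [h1] at h3
    rw [← mul_sum] at h3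
    rw [h5]
    linarith

variable {V : Type*} [Fintype V] {G : SimpleGraph V}

/-- lies in a triangle -/
def InT (G : SimpleGraph V) (v : V) : Prop := ∃ b c, G.Adj v b ∧ G.Adj v c ∧ G.Adj b c

lemma tt_two (hN : Nice G) {v : V} (h : InT G v) : tt G v = 2 := by
  obtain ⟨b, c, hb, hc, hbc⟩ := h
  have : ∀ w u, aa G v w * (aa G v u * aa G w u) = (if b = w then (if c = u then 1 else 0) else 0)
      + (if c = w then (if b = u then 1 else 0) else 0) := by
    intro w u
    by_cases e : G.Adj v w ∧ G.Adj v u ∧ G.Adj w u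
    · have := tri_unique hN.pos hN.h13 hb hc hbc e.1 e.2.1 e.2.2
      unfold aa
      rw [if_pos e.1, if_pos e.2.1, if_pos e.2.2]
      rcases this with ⟨rfl, rfl⟩ | ⟨rfl, rfl⟩ <;> simp [hbc.ne, hbc.ne']
    · have h0 : aa G v w * (aa G v u * aa G w u) = 0 := by
        unfold aa
        split_ifs <;> simp <;> tauto
      rw [h0]
      by_cases e1 : b = w ∧ c = u
      · obtain ⟨rfl, rfl⟩ := e1; tauto
      · by_cases e2 : c = w ∧ b = u
        · obtain ⟨rfl, rfl⟩ := e2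
          exact (e ⟨hc, hb, hbc.symm⟩).elim
        · split_ifs <;> simp <;> tauto
  unfold tt
  simp only [this, sum_add_distrib]
  simp

lemma tt_none {v : V} (h : ¬ InT G v) : tt G v = 0 := by
  unfold tt
  apply sum_eq_zero
  intro w _
  apply sum_eq_zero
  intro u _
  have : ¬ (G.Adj v w ∧ G.Adj v u ∧ G.Adj w u) := fun e => h ⟨w, u, e⟩
  unfold aa
  split_ifs <;> simp <;> tauto

lemma sum_tt (hN : Nice G) : ∑ v, tt G v = 2 * ((univ.filter (InT G)).card : ℤ) := by
  have : ∀ v, tt G v = if InT G v then 2 else 0 := by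
    intro v
    split_ifs with h
    · exact tt_two hN h
    · exact tt_none h
  simp only [this]
  rw [← sum_filter]
  simp; ring

/-- the triangle of `v` -/
noncomputable def tf (G : SimpleGraph V) (v : V) : Finset V :=
  univ.filter (fun w => w = v ∨ ∃ u, G.Adj v w ∧ G.Adj v u ∧ G.Adj w u)

lemma tf_eq (hN : Nice G) {v b c : V} (hb : G.Adj v b) (hc : G.Adj v c) (hbc : G.Adj b c) :
    tf G v = {v, b, c} := by
  ext w
  simp only [tf, mem_filter, mem_univ, true_and, mem_insert, mem_singleton]
  constructor
  · rintro (h | ⟨u, h1, h2, h3⟩)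
    · exact Or.inl h
    · have := tri_unique hN.pos hN.h13 hb hc hbc h1 h2 h3
      tauto
  · rintro (h | rfl | rfl)
    · exact Or.inl h
    · exact Or.inr ⟨c, hb, hc, hbc⟩
    · exact Or.inr ⟨b, hc, hb, hbc.symm⟩

lemma tf_self (v : V) : v ∈ tf G v := by simp [tf]

lemma tf_const (hN : Nice G) {v w : V} (h : InT G v) (hw : w ∈ tf G v) : 
    tf G w = tf G v ∧ InT G w := by
  obtain ⟨b, c, hb, hc, hbc⟩ := h
  rw [tf_eq hN hb hc hbc] at hw ⊢
  simp only [mem_insert, mem_singleton] at hw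
  rcases hw with rfl | rfl | rfl
  · exact ⟨tf_eq hN hb hc hbc, ⟨b, c, hb, hc, hbc⟩⟩
  · refine ⟨?_, ⟨v, c, hb.symm, hbc, hc⟩⟩
    rw [tf_eq hN hb.symm hbc hc]
    ext; simp; tauto
  · refine ⟨?_, ⟨v, b, hc.symm, hbc.symm, hb⟩⟩
    rw [tf_eq hN hc.symm hbc.symm hb]
    ext; simp; tauto

lemma tf_card (hN : Nice G) {v : V} (h : InT G v) : (tf G v).card = 3 := by
  obtain ⟨b, c, hb, hc, hbc⟩ := h
  rw [tf_eq hN hb hc hbc]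
  exact card_eq_three.2 ⟨_, _, _, hb.ne, hc.ne, hbc.ne, rfl⟩

/-- a triangle containing a big vertex -/
def Op (G : SimpleGraph V) (F : Finset V) : Prop := ∃ w ∈ F, 3 ≤ G.degree w

/-- selected big vertex -/
noncomputable def ph (G : SimpleGraph V) (v : V) : V :=
  if h : Op G (tf G v) then h.choose else v

lemma ph_mem {v : V} (h : Op G (tf G v)) : ph G v ∈ tf G v ∧ 3 ≤ G.degree (ph G v) := by
  unfold ph
  rw [dif_pos h]
  exact h.choose_spec

lemma ph_congr {v w : V} (h : Op G (tf G v)) (e : tf G w = tf G v) : ph G w = ph G v := by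
  unfold ph
  rw [dif_pos h, dif_pos (by rw [e]; exact h)]
  simp only [e]

lemma deg_tri {v b c : V} (hb : G.Adj v b) (hc : G.Adj v c) (hbc : G.Adj b c) : 
    2 ≤ G.degree v := by
  rw [← card_neighborFinset_eq_degree]
  have : ({b, c} : Finset V) ⊆ G.neighborFinset v := by
    intro w hw
    simp only [mem_insert, mem_singleton] at hw
    rw [mem_neighborFinset]
    rcases hw with rfl | rfl <;> assumption
  have h2 := card_le_card this
  rwa [card_pair hbc.ne] at h2

lemma closed_tri {v b c : V} (hb : G.Adj v b) (hc : G.Adj v c) (hbc : G.Adj b c)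
    (h : ∀ w ∈ ({v, b, c} : Finset V), G.degree w ≤ 2) : Clo G {v, b, c} := by
  have d1 := deg_tri hb hc hbc
  have d2 := deg_tri hb.symm hbc hc
  have d3 := deg_tri hc.symm hbc.symm hb
  have n1 := deg_two' (by have := h v (by simp); omega) hb hc hbc.ne
  have n2 := deg_two' (by have := h b (by simp); omega) hb.symm hbc hc.ne
  have n3 := deg_two' (by have := h c (by simp); omega) hc.symm hbc.symm hb.ne
  intro a ha d had
  simp only [mem_insert, mem_singleton] at ha ⊢
  rcases ha with rfl | rfl | rfl
  · have := (n1 d).1 had; tauto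
  · have := (n2 d).1 had; tauto
  · have := (n3 d).1 had; tauto

lemma structureThm (hN : Nice G)
    (h33 : ∀ C, Clo G C → zz G (X : ℚ[X]) C ≠ (1 + 3 * X) * (1 + 3 * X))
    (hd : dl G univ = 0) (hsq : 3 * ∑ v, ((G.degree v : ℤ) - 2) ^ 2 = ∑ v, tt G v) :
    StarC G univ ∨ ∃ a b c p, G.Adj a b ∧ G.Adj a c ∧ G.Adj b c ∧ Clo G {a, b, c} ∧
      p ∉ ({a, b, c} : Finset V) ∧
      G.degree p = 3 ∧ (∀ v, G.degree v ≤ 3) ∧ 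
      (∀ v, G.degree v = 3 → v ≠ p → ∃ y z, G.Adj v y ∧ G.Adj v z ∧ G.Adj y z ∧ 
        (G.degree y = 2 ∨ y = p) ∧ (G.degree z = 2 ∨ z = p)) ∧
      (¬ InT G p ∨ ∃ q z, G.Adj p q ∧ G.Adj p z ∧ G.Adj q z ∧ G.degree q = 3 ∧ G.degree z = 2) := by
  set T := univ.filter (InT G) with hT
  set T' := T.filter (fun v => Op G (tf G v)) with hT'
  set T0 := T.filter (fun v => ¬ Op G (tf G v)) with hT0
  set Q := T'.image (ph G) with hQ
  set B := univ.filter (fun v => 3 ≤ G.degree v) with hB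
  have hcard : T'.card + T0.card = T.card := card_filter_add_card_filter_not _
  have mT' : ∀ v, v ∈ T' ↔ InT G v ∧ Op G (tf G v) := by simp [hT', hT]
  have mT0 : ∀ v, v ∈ T0 ↔ InT G v ∧ ¬ Op G (tf G v) := by simp [hT0, hT]
  have mB : ∀ v, v ∈ B ↔ 3 ≤ G.degree v := by simp [hB]
  have hc3 : T'.card = 3 * Q.card := by
    rw [card_eq_sum_card_image (ph G) T', sum_const_nat (m := 3)]
    · ring
    intro q hq
    obtain ⟨v0, hv0, rfl⟩ := mem_image.1 hq
    obtain ⟨t0, o0⟩ := (mT' _).1 hv0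
    rw [← tf_card hN t0]
    congr 1
    ext v
    rw [mem_filter, mT']
    constructor
    · rintro ⟨⟨t1, o1⟩, h1⟩
      have e1 := (tf_const hN t1 (ph_mem o1).1).1
      have e0 := (tf_const hN t0 (ph_mem o0).1).1
      rw [h1] at e1
      rw [← e0, e1]
      exact tf_self v
    · intro hv
      obtain ⟨e1, t1⟩ := tf_const hN t0 hv
      exact ⟨⟨t1, by rw [e1]; exact o0⟩, ph_congr o0 e1⟩
  have hQp : ∀ q ∈ Q, InT G q ∧ Op G (tf G q) ∧ ph G q = q ∧ 3 ≤ G.degree q := by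
    intro q hq
    obtain ⟨v0, hv0, rfl⟩ := mem_image.1 hq
    obtain ⟨t0, o0⟩ := (mT' _).1 hv0
    obtain ⟨e1, t1⟩ := tf_const hN t0 (ph_mem o0).1
    exact ⟨t1, by rw [e1]; exact o0, ph_congr o0 e1, (ph_mem o0).2⟩
  have hQB : Q ⊆ B := fun q hq => (mB q).2 (hQp q hq).2.2.2
  have hsep : ∀ q ∈ Q, ∀ y ∈ Q, y ∈ tf G q → y = q := by
    intro q hq y hy hyq
    obtain ⟨t1, o1, p1, -⟩ := hQp q hq
    obtain ⟨-, -, p2, -⟩ := hQp y hy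
    rw [← p1, ← p2]
    exact ph_congr o1 (tf_const hN t1 hyq).1
  -- closed triangles
  have hT0c : T0 = ∅ ∨ ∃ a b c, G.Adj a b ∧ G.Adj a c ∧ G.Adj b c ∧ Clo G {a, b, c} ∧ 
      (∀ w ∈ ({a, b, c} : Finset V), G.degree w ≤ 2) ∧ T0.card = 3 := by
    rcases T0.eq_empty_or_nonempty with h | ⟨v, hv⟩
    · exact Or.inl h
    right
    have key : ∀ v ∈ T0, Clo G (tf G v) ∧ zz G (X : ℚ[X]) (tf G v) = 1 + 3 * X := by
      intro v hv
      obtain ⟨⟨b, c, hb, hc, hbc⟩, ho⟩ := (mT0 v).1 hv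
      rw [tf_eq hN hb hc hbc] at ho ⊢
      refine ⟨closed_tri hb hc hbc ?_, zz_tri hb hbc hc⟩
      intro w hw
      by_contra hh
      exact ho ⟨w, hw, by omega⟩
    have hT0v : T0 = tf G v := by
      ext w
      constructor
      · intro hw
        by_contra hwv
        obtain ⟨c1, z1⟩ := key v hv
        obtain ⟨c2, z2⟩ := key w hw
        have hdj : Disjoint (tf G v) (tf G w) := by
          rw [Finset.disjoint_left]
          intro u hu1 hu2
          have e1 := (tf_const hN ((mT0 v).1 hv).1 hu1).1
          have e2 := (tf_const hN ((mT0 w).1 hw).1 hu2).1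
          rw [← e1, e2] at hwv
          exact hwv (tf_self w)
        refine h33 (tf G v ∪ tf G w) ?_ ?_
        · intro a ha b hab
          rw [mem_union] at ha ⊢
          exact ha.imp (fun h => c1 a h b hab) (fun h => c2 a h b hab)
        · rw [zz_union hdj (fun a ha b hb hab => Finset.disjoint_left.1 hdj (c1 a ha b hab) hb), z1, z2]
      · intro hw
        obtain ⟨t1, o1⟩ := (mT0 v).1 hv
        obtain ⟨e1, t2⟩ := tf_const hN t1 hw
        rw [mT0, e1]
        exact ⟨t2, o1⟩
    obtain ⟨t1, o1⟩ := (mT0 v).1 hv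
    have hc := tf_card hN t1
    obtain ⟨b, c, hb, hc', hbc⟩ := t1
    have htf := tf_eq hN hb hc' hbc
    refine ⟨v, b, c, hb, hc', hbc, ?_, ?_, ?_⟩
    · rw [← htf]; exact (key v hv).1
    · rw [← htf]
      intro w hw
      by_contra hh
      exact o1 ⟨w, hw, by omega⟩
    · rw [hT0v, hc]
  -- the sum
  have hsum : 3 * ∑ v ∈ B, ((G.degree v : ℤ) - 2) * (G.degree v - 1) = 2 * T.card := by
    rw [hT, ← sum_tt hN, ← hsq]
    have h1 : ∑ v ∈ B, ((G.degree v : ℤ) - 2) * (G.degree v - 1) = 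
        ∑ v, ((G.degree v : ℤ) - 2) * (G.degree v - 1) := by
      apply sum_subset (subset_univ _)
      intro v _ hv
      rw [mB] at hv
      have := hN.deg0 v
      rcases (by omega : G.degree v = 1 ∨ G.degree v = 2) with h | h <;> rw [h] <;> norm_num
    have h2 : ∑ v, ((G.degree v : ℤ) - 2) * (G.degree v - 1) = 
        ∑ v, ((G.degree v : ℤ) - 2) ^ 2 + dl G univ := by
      unfold dl
      rw [← sum_add_distrib]
      apply sum_congr rfl
      intro v _; ring
    rw [h1, h2, hd, add_zero]
  have hT0le : T0.card = 0 ∨ T0.card = 3 := by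
    rcases hT0c with h | ⟨_, _, _, _, _, _, _, _, h⟩
    · left; rw [h]; rfl
    · exact Or.inr h
  have hQle := card_le_card hQB
  have hge : ∀ v ∈ B, (0:ℤ) ≤ ((G.degree v : ℤ) - 2) * (G.degree v - 1) - 2 := by
    intro v hv
    rw [mB] at hv
    have : (3:ℤ) ≤ G.degree v := by exact_mod_cast hv
    nlinarith
  have hsum2 : ∑ v ∈ B, (((G.degree v : ℤ) - 2) * (G.degree v - 1) - 2) = 
      ∑ v ∈ B, ((G.degree v : ℤ) - 2) * (G.degree v - 1) - 2 * B.card := by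
    rw [sum_sub_distrib]; simp; ring
  have hdeg3 : ∀ v, G.degree v ≤ 3 := by
    intro v
    by_contra hv
    have hvB : v ∈ B := (mB v).2 (by omega)
    have h1 := single_le_sum hge hvB
    have : (4:ℤ) ≤ G.degree v := by exact_mod_cast (by omega : 4 ≤ G.degree v)
    have h2 : (4:ℤ) ≤ ((G.degree v : ℤ) - 2) * (G.degree v - 1) - 2 := by nlinarith
    have h3 : (4:ℤ) ≤ ∑ v ∈ B, (((G.degree v : ℤ) - 2) * (G.degree v - 1) - 2) := h2.trans h1
    omega
  have hsum3 : ∑ v ∈ B, ((G.degree v : ℤ) - 2) * (G.degree v - 1) = 2 * B.card := by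
    rw [sum_congr rfl (g := fun _ => (2:ℤ))]
    · simp; ring
    · intro v hv
      rw [mB] at hv
      rw [show G.degree v = 3 by have := hdeg3 v; omega]
      norm_num
  have hBQ : 3 * B.card = 3 * Q.card + T0.card := by omega
  have hdeg2 : ∀ v b c, G.Adj v b → G.Adj v c → G.Adj b c → v ∉ B → G.degree v = 2 := by
    intro v b c hb hc hbc hv
    rw [mB] at hv
    have := deg_tri hb hc hbc
    omega
  rcases hT0c with h | ⟨a, b, c, hab, hac, hbc, hcl, hle2, h3⟩
  · left
    rw [h, card_empty] at hBQ
    have hBQ' : Q = B := eq_of_subset_of_card_le hQB (by omega)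
    intro v _
    by_cases hv : v ∈ B
    · right; right
      have hdv : G.degree v = 3 := by rw [mB] at hv; have := hdeg3 v; omega
      rw [← hBQ'] at hv
      obtain ⟨⟨y, z, hy, hz, hyz⟩, -⟩ := hQp v hv
      have htf := tf_eq hN hy hz hyz
      refine ⟨hdv, y, z, hy, hz, hyz, ?_, ?_⟩
      · refine hdeg2 y v z hy.symm hyz hz (fun hB => hy.ne ?_)
        rw [← hBQ'] at hB
        exact (hsep v hv y hB (by rw [htf]; simp)).symm
      · refine hdeg2 z v y hz.symm hyz.symm hy (fun hB => hz.ne ?_)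
        rw [← hBQ'] at hB
        exact (hsep v hv z hB (by rw [htf]; simp)).symm
    · rw [mB] at hv
      have := hN.deg0 v
      omega
  · right
    rw [h3] at hBQ
    have hone : (B \ Q).card = 1 := by
      rw [card_sdiff_of_subset hQB]; omega
    obtain ⟨p, hp⟩ := card_eq_one.1 hone
    have hpB : p ∈ B \ Q := by rw [hp]; simp
    rw [mem_sdiff] at hpB
    have hBp : ∀ v ∈ B, v ≠ p → v ∈ Q := by
      intro v hv hvp
      by_contra hvQ
      have : v ∈ B \ Q := mem_sdiff.2 ⟨hv, hvQ⟩
      rw [hp, mem_singleton] at this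
      exact hvp this
    refine ⟨a, b, c, p, hab, hac, hbc, hcl, ?_, ?_, hdeg3, ?_, ?_⟩
    · intro hpa
      have := hle2 p hpa
      have := (mB p).1 hpB.1
      omega
    · have := (mB p).1 hpB.1
      have := hdeg3 p
      omega
    · intro v hdv hvp
      have hv : v ∈ Q := hBp v ((mB v).2 (by omega)) hvp
      obtain ⟨⟨y, z, hy, hz, hyz⟩, -⟩ := hQp v hv
      have htf := tf_eq hN hy hz hyz
      refine ⟨y, z, hy, hz, hyz, ?_, ?_⟩
      · by_cases hyp : y = p
        · exact Or.inr hyp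
        refine Or.inl (hdeg2 y v z hy.symm hyz hz (fun hB => hy.ne ?_))
        exact (hsep v hv y (hBp y hB hyp) (by rw [htf]; simp)).symm
      · by_cases hyp : z = p
        · exact Or.inr hyp
        refine Or.inl (hdeg2 z v y hz.symm hyz.symm hy (fun hB => hz.ne ?_))
        exact (hsep v hv z (hBp z hB hyp) (by rw [htf]; simp)).symm
    · by_cases hpT : InT G p
      · right
        have hop : Op G (tf G p) := ⟨p, tf_self p, (mB p).1 hpB.1⟩
        obtain ⟨hq1, hq2⟩ := ph_mem hop
        have hqQ : ph G p ∈ Q := mem_image_of_mem _ ((mT' p).2 ⟨hpT, hop⟩)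
        set q := ph G p with hq
        have hqp : q ≠ p := fun e => hpB.2 (e ▸ hqQ)
        have hdq : G.degree q = 3 := by have := hdeg3 q; omega
        have : ∃ z, G.Adj p q ∧ G.Adj p z ∧ G.Adj q z := by
          simp only [tf, mem_filter, mem_univ, true_and] at hq1
          rcases hq1 with h | h
          · exact absurd h hqp
          · exact h
        obtain ⟨z, h1, h2, h4⟩ := this
        refine ⟨q, z, h1, h2, h4, hdq, ?_⟩
        refine hdeg2 z p q h2.symm h4.symm h1 (fun hB => h4.ne ?_)
        refine (hsep q hqQ z (hBp z hB h2.ne') ?_).symm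
        rw [tf_eq hN h1.symm h4 h2]; simp
      · exact Or.inl hpT

end Work

set_option linter.unusedSectionVars false
section Work
open scoped Classical
open Finset
variable {V : Type*} [Fintype V] {G : SimpleGraph V}

/-- the exceptional case -/
structure Ctx (G : SimpleGraph V) (n : ℕ) (A : Finset V) (p : V) : Prop where
  hN : Nice G
  hodd : Odd n
  h9 : n ≠ 9
  h15 : n ≠ 15
  hV : Fintype.card V = n
  hw : ww G univ = 2
  hz : zz G (2:ℤ) univ = 2 ^ n - 1
  hd : dl G univ = 0
  hA : Clo G A
  wA : ww G A = 2
  zA : zz G (2:ℤ) A = 7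
  dA : dl G A = 0
  cA : A.card = 3
  hp : p ∉ A
  hp3 : G.degree p = 3
  hdeg : ∀ v, G.degree v ≤ 3
  htri : ∀ v, G.degree v = 3 → v ≠ p → ∃ y z, G.Adj v y ∧ G.Adj v z ∧ G.Adj y z ∧ 
        (G.degree y = 2 ∨ y = p) ∧ (G.degree z = 2 ∨ z = p)

lemma Ctx.rest {n : ℕ} {A : Finset V} {p : V} (h : Ctx G n A p) {B : Finset V} (hB : Clo G B)
    (hpB : p ∈ B) (hBA : ∀ U, Clo G U → p ∈ U → B ⊆ U) :
    dl G B = 0 ∧ ∃ j : ℕ, ww G B * 2 ^ j = 1 ∧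
      (j = 0 → n = B.card + 3 ∧ 2 ^ n - 1 = 7 * zz G (2:ℤ) B) ∧
      (j = 1 → ∃ k, n = B.card + 3 + k ∧ 2 ^ n - 1 = 7 * zz G (2:ℤ) B * ll 2 k) := by
  have hu : Clo G (univ : Finset V) := fun _ _ _ _ => mem_univ _
  have hUA := hu.sdiff h.hA
  have hBs : B ⊆ univ \ A := hBA _ hUA (by simp [h.hp])
  have hU := hUA.sdiff hB
  have hs : StarC G ((univ \ A) \ B) := by
    intro v hv
    simp only [mem_sdiff, mem_univ, true_and] at hv
    have h1 := h.hdeg v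
    have h2 := h.hN.deg0 v
    by_cases h3 : G.degree v = 3
    · right; right
      obtain ⟨y, z, hy, hz, hyz, ey, ez⟩ := h.htri v h3 (fun e => hv.2 (e ▸ hpB))
      refine ⟨h3, y, z, hy, hz, hyz, ?_, ?_⟩
      · rcases ey with e | rfl
        · exact e
        · exact (hv.2 (hB _ hpB _ hy.symm)).elim
      · rcases ez with e | rfl
        · exact e
        · exact (hv.2 (hB _ hpB _ hz.symm)).elim
    · omega
  obtain ⟨j, j1, j2, j3, j4⟩ := peel_all h.hN hU hs
  have w1 := ww_clo h.hA (subset_univ A)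
  rw [ww_clo hB hBs, h.hw, h.wA, j1] at w1
  have d1 := dl_clo (G := G) (subset_univ A)
  rw [dl_clo hBs, h.hd, h.dA, j2] at d1
  have z1 := zz_clo (x := (2:ℤ)) h.hA (subset_univ A)
  rw [zz_clo hB hBs, h.hz, h.zA] at z1
  have c1 := card_sdiff_add_card_eq_card (subset_univ A)
  have c2 := card_sdiff_add_card_eq_card hBs
  rw [card_univ, h.hV, h.cA] at c1
  refine ⟨by linarith, j, by linarith, ?_, ?_⟩
  · intro hj
    rw [j3 hj] at c2 z1
    rw [zz_empty] at z1
    rw [card_empty] at c2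
    exact ⟨by omega, by linarith⟩
  · intro hj
    refine ⟨((univ \ A) \ B).card, by omega, ?_⟩
    rw [← (j4 hj).2.2.1 ℤ 2]
    linarith

lemma Ctx.fin_end {n : ℕ} {A : Finset V} {p : V} (h : Ctx G n A p) {B : Finset V} (hB : Clo G B)
    (hpB : p ∈ B) (hBA : ∀ U, Clo G U → p ∈ U → B ⊆ U) (m : ℕ) (hw : ww G B = 2 - m / 2)
    (h2 : m = 2 → B.card = 6) (h3 : m = 3 → B.card = 7 ∧ zz G (2:ℤ) B = 151) : False := by
  obtain ⟨-, j, j1, j2, j3⟩ := h.rest hB hpB hBA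
  rw [hw] at j1
  have hpos : (0:ℝ) < 2 ^ j := by positivity
  have hm : m < 4 := by
    by_contra hm
    have : (4:ℝ) ≤ m := by exact_mod_cast (by omega : 4 ≤ m)
    nlinarith
  have j1' : ((4:ℤ) - m) * 2 ^ j = 2 := by
    have : ((4:ℝ) - m) * 2 ^ j = 2 := by linarith
    exact_mod_cast this
  interval_cases m
  · norm_num at j1'
    have : (0:ℤ) < 2 ^ j := by positivity
    omega
  · norm_num at j1'
    have : (0:ℤ) < 2 ^ j := by positivity
    omega
  · have hj : j = 0 := by
      rcases Nat.eq_zero_or_pos j with e | e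
      · exact e
      · obtain ⟨i, rfl⟩ : ∃ i, j = i + 1 := ⟨j - 1, by omega⟩
        norm_num [pow_succ] at j1'
        omega
    have := (j2 hj).1
    have := h2 rfl
    exact h.h9 (by omega)
  · have hj : j = 1 := by
      rcases Nat.lt_or_ge j 2 with e | e
      · interval_cases j
        · norm_num at j1'
        · rfl
      · obtain ⟨i, rfl⟩ : ∃ i, j = i + 2 := ⟨j - 2, by omega⟩
        norm_num [pow_succ] at j1'
        omega
    obtain ⟨k, k1, k2⟩ := j3 hj
    obtain ⟨c1, c2⟩ := h3 rfl
    have hk : Odd k := by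
      have := h.hodd
      rw [k1, c1] at this
      rw [Nat.odd_iff] at this ⊢
      omega
    rw [ll_two_odd hk, c2, k1, c1, pow_add] at k2
    have : (2:ℤ) ^ k = 2 ^ 5 := by norm_num at k2 ⊢; linarith
    have := pow_right_injective₀ (by norm_num : (0:ℤ) < 2) (by norm_num) this
    exact h.h15 (by omega)

lemma Tail.adjS {S : Finset V} {v : V} {l : List V} (h : Tail G S v l) : ∀ a ∈ l, ∀ b ∈ S, 
    G.Adj a b → b = v := by
  induction h with
  | nil => simp
  | cons t l h1 h2 h3 h4 ih =>
    intro a ha b hb hab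
    rcases List.mem_cons.1 ha with rfl | ha
    · have := (h4 b (Or.inl hb)).1 hab
      cases l with
      | nil => simpa using this
      | cons s l =>
        simp only [List.headD_cons] at this
        subst this
        exact (h1.disj b (by simp) hb).elim
    · exact ih a ha b hb hab

lemma Tail.uniq {S : Finset V} {v : V} {l : List V} (h : Tail G S v l) (hv : v ∈ S) : 
    ∀ a ∈ l, ∀ b ∈ l, G.Adj a v → G.Adj b v → a = b := by
  induction h with
  | nil => simp
  | cons t l h1 h2 h3 h4 ih =>
    have key : G.Adj t v → l = [] := by
      intro ht
      have := (h4 v (Or.inl hv)).1 ht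
      cases l with
      | nil => rfl
      | cons s l =>
        simp only [List.headD_cons] at this
        subst this
        exact (h1.disj v (by simp) hv).elim
    intro a ha b hb h5 h6
    rcases List.mem_cons.1 ha with rfl | ha2
    · rw [key h5] at hb
      simp at hb
      exact hb.symm
    · rcases List.mem_cons.1 hb with rfl | hb2
      · rw [key h6] at ha2
        simp at ha2
      · exact ih a ha2 b hb2 h5 h6

lemma hit_gen (hN : Nice G) (E : V → V → Prop) {S S₀ : Finset V} {v : V} (h0 : S₀ ⊆ S)
    (h : Tight G S₀ v)
    {l : List V} (hl : Tail G S v l) {u b c : V} (hu : ¬ (u ∈ S ∨ u ∈ l))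
    (hvu : G.Adj (l.headD v) u) (hub : G.Adj u b) (huc : G.Adj u c) (hbc : G.Adj b c)
    (hleave : ∀ a, (a ∈ S ∨ a ∈ l) → ∀ b, ¬ (b ∈ S ∨ b ∈ l) → G.Adj a b →
          (a = l.headD v ∧ b = u) ∨ (a ∈ S ∧ E a b)) (hEb : ∀ w, ¬ E b w) (hEc : ∀ w, ¬ E c w) :
    False := by
  have hl' : ∀ a, a = b ∨ a = c → (a ∈ S ∨ a ∈ l) → ∀ d, ¬ (d ∈ S ∨ d ∈ l) → G.Adj a d →
          (a = l.headD v ∧ d = u) := by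
    rintro a (rfl | rfl) ha d hd had
    · rcases hleave a ha d hd had with h | h
      · exact h
      · exact (hEb _ h.2).elim
    · rcases hleave a ha d hd had with h | h
      · exact h
      · exact (hEc _ h.2).elim
  have mono : ∀ w, ¬ (w ∈ S ∨ w ∈ l) → ¬ (w ∈ S₀ ∨ w ∈ l) := by
    intro w hw hh
    exact hw (hh.imp (fun e => h0 e) id)
  by_cases hb : b ∈ S ∨ b ∈ l
  · have h1 := (hl' b (Or.inl rfl) hb u hu hub.symm).1
    by_cases hc : c ∈ S ∨ c ∈ l
    · have h2 := (hl' c (Or.inr rfl) hc u hu huc.symm).1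
      exact hbc.ne (h1.trans h2.symm)
    · exact huc.ne (hl' b (Or.inl rfl) hb c hc hbc).2.symm
  · by_cases hc : c ∈ S ∨ c ∈ l
    · exact hub.ne (hl' c (Or.inr rfl) hc b hb hbc.symm).2.symm
    · exact tight_hit hN.pos h (hl.mono h0) (mono u hu) hvu (mono b hb) (mono c hc) hub huc hbc

lemma dl_insert {S : Finset V} {u : V} (hu : u ∉ S) : 
    dl G (insert u S) = dl G S + ((G.degree u : ℤ) - 2) := by
  unfold dl; rw [sum_insert hu, add_comm]

lemma ff_q (k : ℕ) : ff (-1/4 : ℝ) k = 2 * k / 2 ^ k := by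
  rw [eq_div_iff (by positivity), mul_comm, ff_quarter]

lemma ll_q (k : ℕ) : ll (-1/4 : ℝ) k = 2 / 2 ^ k := by
  rw [eq_div_iff (by positivity), mul_comm, ll_quarter]

lemma Ctx.caseA {n : ℕ} {A : Finset V} {p : V} (h : Ctx G n A p) {q z : V} (hpq : G.Adj p q) 
    (hpz : G.Adj p z) (hqz : G.Adj q z) (dq : G.degree q = 3) (dz : G.degree z = 2) : False := by
  obtain ⟨r, hr1, hr2, np⟩ := deg_three h.hp3 hpq hpz hqz.ne
  obtain ⟨s, hs1, hs2, nq⟩ := deg_three dq hpq.symm hqz hpz.ne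
  have nz := deg_two' dz hpz.symm hqz.symm hpq.ne
  have hpr : G.Adj p r := (np r).2 (by simp)
  have hqs : G.Adj q s := (nq s).2 (by simp)
  have hN := h.hN
  have hrs : r ≠ s := by
    rintro rfl
    have := tri_unique hN.pos hN.h13 hpq hpz hqz hpq hpr hqs
    have := hqz.ne
    tauto
  have dS : dl G {p, q, z} = 2 := by
    unfold dl
    rw [sum_insert (by simp [hpq.ne, hpz.ne]), sum_insert (by simp [hqz.ne]), sum_singleton, 
      h.hp3, dq, dz]
    norm_num
  have cS : ({p, q, z} : Finset V).card = 3 := 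
    card_eq_three.2 ⟨_, _, _, hpq.ne, hpz.ne, hqz.ne, rfl⟩
  have hSU : ∀ U, Clo G U → p ∈ U → ({p, q, z} : Finset V) ⊆ U := by
    intro U hU hpU w hw
    simp only [mem_insert, mem_singleton] at hw
    rcases hw with rfl | rfl | rfl
    · exact hpU
    · exact hU _ hpU _ hpq
    · exact hU _ hpU _ hpz
  obtain ⟨l, hT, hcase⟩ := grow (G := G) (fun a b => a = q ∧ b = s) (S := {p, q, z}) (v := p) 
    (u₀ := r) (by simp) (by simp [hpr.ne', hr1, hr2]) hpr (by
      intro a ha b hb hab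
      simp only [mem_insert, mem_singleton, not_or] at ha hb
      rcases ha with rfl | rfl | rfl
      · have := (np b).1 hab; tauto
      · have := (nq b).1 hab; tauto
      · have := (nz b).1 hab; tauto)
  rcases hcase with ⟨t, l', rfl, h1, h2, hleave⟩ | ⟨u, hu, hadj, h0, hl, hleave, hend⟩
  · -- leaf
    set l := t :: l' with hl
    have hsl : s ∉ l := fun hs => hpq.ne' (hT.adjS s hs q (by simp) hqs.symm)
    have hsS : s ∉ ({p, q, z} : Finset V) := by simp [hs1, hs2, hqs.ne']
    have hql : q ∉ l := fun hq => hT.disj q hq (by simp)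
    obtain ⟨l2, hT2, hcase⟩ := grow (G := G) (fun a b => False) (S := {p, q, z} ∪ l.toFinset) 
      (v := q) (u₀ := s) (by simp) (by rw [mem_union, List.mem_toFinset]; tauto) hqs (by
        intro a ha b hb hab
        rw [mem_union, List.mem_toFinset] at ha hb
        exact Or.inl (hleave a ha b hb hab).2)
    rcases hcase with ⟨t2, l2', rfl, g1, g2, gleave⟩ | ⟨u, hu, hadj, h0, hl, gleave, hend⟩
    · set l2 := t2 :: l2' with hl2
      have hzz : ∀ (R : Type) [CommRing R] (x : R), 
          zz G x ({p, q, z} ∪ l.toFinset ∪ l2.toFinset) = 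
            ff x (l2.length + 1) * (ff x (l.length + 1) * (1 + 3 * x) + x * ff x l.length * (1 + 2 * x))
            + x * ff x l2.length * (ff x (l.length + 1) * (1 + 2 * x) + x * ff x l.length * (1 + x)) := by
        intro R _ x
        have e : ({p, q, z} ∪ l.toFinset).erase q = {p, z} ∪ l.toFinset := by
          ext w
          simp only [mem_erase, mem_union, mem_insert, mem_singleton, List.mem_toFinset]
          have := hpq.ne
          have := hqz.ne'
          constructor
          · tauto
          · rintro ((rfl | rfl) | h)
            · tauto
            · tauto
            · refine ⟨?_, by tauto⟩
              rintro rfl; exact hql h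
        rw [zz_tail hT2 subset_rfl, zz_tail hT subset_rfl, e, zz_tail hT (Q := {p, z}) (by 
          intro w; simp; tauto), zz_tri hpq hqz hpz, erase_insert (by simp [hpq.ne, hpz.ne]),
          erase_insert (by simp [hpz.ne]), zz_pair hqz, zz_pair hpz, zz_single]
      have hcard : ({p, q, z} ∪ l.toFinset ∪ l2.toFinset).card = 3 + l.length + l2.length := by
        rw [hT2.cardU, hT.cardU, cS]
      have hl1 : 1 ≤ l.length := by rw [hl]; simp
      have hl3 : 1 ≤ l2.length := by rw [hl2]; simp
      generalize l.length = α at *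
      generalize l2.length = β at *
      refine h.fin_end (B := {p, q, z} ∪ l.toFinset ∪ l2.toFinset) ?_ (by simp) ?_ (α * β) ?_ ?_ ?_
      · intro a ha b hab
        by_contra hb
        rw [mem_union, List.mem_toFinset] at ha hb
        exact (gleave a ha b hb hab).2
      · intro U hU hpU
        have e1 := hT.sub (by simp) hU hpU
        have e2 := hT2.sub (by simp) hU (hU _ hpU _ hpq)
        intro w hw
        rw [mem_union, mem_union, List.mem_toFinset, List.mem_toFinset] at hw
        rcases hw with (hw | hw) | hw
        · exact hSU U hU hpU hw
        · exact e1.1 w hw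
        · exact e2.1 w hw
      · unfold ww
        rw [hzz, hcard]
        simp only [ff_q, pow_add]
        push_cast
        field_simp
        ring
      · intro hm
        rw [hcard]
        have : α ≤ 2 := by nlinarith
        have : β ≤ 2 := by nlinarith
        clear hzz hcard
        interval_cases α <;> interval_cases β <;> omega
      · intro hm
        rw [hcard, hzz]
        have : α ≤ 3 := by nlinarith
        have : β ≤ 3 := by nlinarith
        clear hzz hcard
        interval_cases α <;> interval_cases β <;> first | omega | (constructor <;> norm_num [ff])
    · have h3 : 3 ≤ G.degree u := by
        rcases hend with ⟨_, _, h, _⟩ | h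
        · exact h.elim
        · exact h
      have hup : u ≠ p := by rintro rfl; exact hu (by simp)
      obtain ⟨b, c, hb, hc, hbc, -, -⟩ := h.htri u (by have := h.hdeg u; omega) hup
      refine hit_gen hN (fun _ _ => False) (S₀ := {q, p, z}) ?_ 
        (tight_tri hpq.symm hpz hqz) hT2 hu hadj hb hc hbc gleave (by simp) (by simp)
      intro w hw
      simp only [mem_insert, mem_singleton, mem_union] at hw ⊢
      tauto
  · rcases hend with ⟨a, ha, ⟨rfl, rfl⟩, hau, hah, hdu⟩ | h3
    · -- close
      have hnu := deg_two' hdu hadj.symm hau.symm hah.symm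
      have hcl : Clo G (insert u ({p, a, z} ∪ l.toFinset)) := by
        intro b hb d hbd
        by_contra hd
        simp only [mem_insert (a := b) (b := u), mem_insert (a := d) (b := u), mem_union, 
          List.mem_toFinset, not_or] at hb hd
        rcases hb with rfl | hb
        · rcases (hnu d).1 hbd with rfl | rfl
          · have := hT.headD_mem (by simp); tauto
          · simp at hd
        · have := hleave b hb d (by tauto) hbd
          tauto
      have := (h.rest hcl (by simp) (by
        intro U hU hpU w hw
        have e1 := hT.sub (by simp) hU hpU
        simp only [mem_insert (a := w) (b := u), mem_union, List.mem_toFinset] at hw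
        rcases hw with rfl | hw | hw
        · exact hU _ e1.2 _ hadj
        · exact hSU U hU hpU hw
        · exact e1.1 w hw)).1
      rw [dl_insert (by rw [mem_union, List.mem_toFinset]; exact hu), hT.dl2 hl, dS, hdu] at this
      norm_num at this
    · have hup : u ≠ p := by rintro rfl; exact hu (by simp)
      obtain ⟨b, c, hb, hc, hbc, -, -⟩ := h.htri u (by have := h.hdeg u; omega) hup
      have key : ∀ b c, G.Adj u b → G.Adj u c → G.Adj b c → b ≠ q := by
        rintro b c hb hc hbc rfl
        have := tri_unique hN.pos hN.h13 hpq.symm hqz hpz hb.symm hbc hc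
        apply hu
        simp
        tauto
      refine hit_gen hN _ subset_rfl 
        (tight_tri hpq hqz hpz) hT hu hadj hb hc hbc hleave ?_ ?_
      · intro w hw; exact key b c hb hc hbc hw.1
      · intro w hw; exact key c b hc hb hbc.symm hw.1

end Work

set_option linter.unusedSectionVars false
section Work
open scoped Classical
open Finset
variable {V : Type*} [Fintype V] {G : SimpleGraph V}

lemma two_arms {S : Finset V} {p u1 u2 : V} (hp : p ∈ S) (h1 : u1 ∉ S) (h2 : u2 ∉ S) 
    (h12 : u1 ≠ u2) (a1 : G.Adj p u1) (a2 : G.Adj p u2)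
    (hS : ∀ a ∈ S, ∀ b, b ∉ S → G.Adj a b → a = p ∧ (b = u1 ∨ b = u2))
    (hbad : ∀ T, S ⊆ T → ∀ E : V → V → Prop, (∀ a b, E a b → a = p) → ∀ l u, Tail G T p l → 
      ¬ (u ∈ T ∨ u ∈ l) → G.Adj (l.headD p) u → 3 ≤ G.degree u → 
      (∀ a, (a ∈ T ∨ a ∈ l) → ∀ b, ¬ (b ∈ T ∨ b ∈ l) → G.Adj a b →
          (a = l.headD p ∧ b = u) ∨ (a ∈ T ∧ E a b)) → False) :
    (∃ l1 l2, 1 ≤ l1.length ∧ 1 ≤ l2.length ∧ Tail G S p l1 ∧ Tail G (S ∪ l1.toFinset) p l2 ∧ 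
      Clo G (S ∪ l1.toFinset ∪ l2.toFinset) ∧ dl G (S ∪ l1.toFinset ∪ l2.toFinset) = dl G S - 2) ∨ 
    (∃ t l u, Tail G S p (t :: l) ∧ ¬ (u ∈ S ∨ u ∈ t :: l) ∧ (∀ b, G.Adj u b ↔ b = t ∨ b = p) ∧ 
      Clo G (insert u (S ∪ (t :: l).toFinset)) ∧ dl G (insert u (S ∪ (t :: l).toFinset)) = dl G S) := by
  obtain ⟨l, hT, hcase⟩ := grow (G := G) (fun a b => a = p ∧ b = u2) (S := S) (v := p) 
    (u₀ := u1) hp h1 a1 (by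
      intro a ha b hb hab
      have := hS a ha b hb hab
      tauto)
  rcases hcase with ⟨t, l', rfl, g1, g2, hleave⟩ | ⟨u, hu, hadj, h0, hl, hleave, hend⟩
  · left
    have hu2 : u2 ∉ t :: l' := by
      intro hm
      by_cases hm1 : u1 ∈ t :: l'
      · exact h12 (hT.uniq hp _ hm1 _ hm a1.symm a2.symm)
      · exact h12 (hleave p (Or.inl hp) u1 (by tauto) a1).2.2
    obtain ⟨l2, hT2, hcase⟩ := grow (G := G) (fun a b => False) (S := S ∪ (t :: l').toFinset) 
      (v := p) (u₀ := u2) (by simp [hp]) (by rw [mem_union, List.mem_toFinset]; tauto) a2 (by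
        intro a ha b hb hab
        rw [mem_union, List.mem_toFinset] at ha hb
        exact Or.inl (hleave a ha b hb hab).2)
    rcases hcase with ⟨t2, l2', rfl, k1, k2, kleave⟩ | ⟨u, hu, hadj, h0, hl, kleave, hend⟩
    · refine ⟨_, _, by simp, by simp, hT, hT2, ?_, ?_⟩
      · intro a ha b hab
        by_contra hb
        rw [mem_union, List.mem_toFinset] at ha hb
        exact (kleave a ha b hb hab).2
      · rw [hT2.dl1 k1 k2, hT.dl1 g1 g2]; ring
    · have h3 : 3 ≤ G.degree u := by
        rcases hend with ⟨_, _, h, _⟩ | h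
        · exact h.elim
        · exact h
      exact (hbad _ subset_union_left _ (by simp) l2 u hT2 hu hadj h3 kleave).elim
  · rcases hend with ⟨a, ha, ⟨rfl, rfl⟩, hau, hah, hdu⟩ | h3
    · right
      have hnu := deg_two' hdu hadj.symm hau.symm hah.symm
      cases l with
      | nil => exact (h12 (h0 rfl).symm).elim
      | cons t l =>
        refine ⟨t, l, u, hT, hu, hnu, ?_, ?_⟩
        · intro b hb d hbd
          by_contra hd
          simp only [mem_insert (a := b) (b := u), mem_insert (a := d) (b := u), mem_union, 
            List.mem_toFinset, not_or] at hb hd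
          rcases hb with rfl | hb
          · rcases (hnu d).1 hbd with rfl | rfl
            · simp at hd
            · tauto
          · have := hleave b hb d (by tauto) hbd
            tauto
        · rw [dl_insert (by rw [mem_union, List.mem_toFinset]; exact hu), hT.dl2 hl, hdu]
          norm_num
    · exact (hbad _ subset_rfl _ (fun a b h => h.1) l u hT hu hadj h3 hleave).elim

lemma arm_ext {S : Finset V} {v p : V} {l : List V} (hv : v ∈ S) (hT : Tail G S v l) 
    (hu : ¬ (p ∈ S ∨ p ∈ l)) (hadj : G.Adj (l.headD v) p) 
    (hleave : ∀ a, (a ∈ S ∨ a ∈ l) → ∀ b, ¬ (b ∈ S ∨ b ∈ l) → G.Adj a b → (a = l.headD v ∧ b = p))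
    (hp3 : G.degree p = 3) : 
    Tail G S v (p :: l) ∧ ∃ u1 u2, u1 ∉ S ∪ (p :: l).toFinset ∧ u2 ∉ S ∪ (p :: l).toFinset ∧ u1 ≠ u2 ∧
      G.Adj p u1 ∧ G.Adj p u2 ∧ ∀ a ∈ S ∪ (p :: l).toFinset, ∀ b, b ∉ S ∪ (p :: l).toFinset → 
        G.Adj a b → a = p ∧ (b = u1 ∨ b = u2) := by
  have hh := hT.headD_mem hv
  have key : ∀ a, (a ∈ S ∨ a ∈ l) → G.Adj p a → a = l.headD v := fun a ha hpa => 
    (hleave a ha p hu hpa.symm).1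
  obtain ⟨u1, u2, e1, e2, e12, hn⟩ := deg_three_one hp3 hadj.symm
  have b1 : G.Adj p u1 := (hn u1).2 (by simp)
  have b2 : G.Adj p u2 := (hn u2).2 (by simp)
  refine ⟨.cons p l hT (by tauto) (by tauto) ?_, u1, u2, ?_, ?_, e12, b1, b2, ?_⟩
  · intro a ha
    refine ⟨key a ha, ?_⟩
    rintro rfl; exact hadj.symm
  · intro hm
    rw [mem_union, List.mem_toFinset, List.mem_cons] at hm
    have := b1.ne'
    exact e1 (key u1 (by tauto) b1)
  · intro hm
    rw [mem_union, List.mem_toFinset, List.mem_cons] at hm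
    have := b2.ne'
    exact e2 (key u2 (by tauto) b2)
  · intro a ha b hb hab
    rw [mem_union, List.mem_toFinset, List.mem_cons] at ha hb
    by_cases hap : a = p
    · subst hap
      refine ⟨rfl, ?_⟩
      rcases (hn b).1 hab with rfl | h | h
      · tauto
      · exact Or.inl h
      · exact Or.inr h
    · have := (hleave a (by tauto) b (by tauto) hab).2
      tauto

lemma Tail.sub_rev {S U : Finset V} {v p : V} {l : List V} (h : Tail G S v (p :: l)) (hv : v ∈ S)
    (hU : Clo G U) (hp : p ∈ U) : v ∈ U ∧ ∀ a ∈ p :: l, a ∈ U := by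
  have hvU : v ∈ U := by
    by_contra hc
    have hu : Clo G (univ : Finset V) := fun _ _ _ _ => mem_univ _
    have := (h.sub hv (hu.sdiff hU) (by simp [hc])).2
    simp at this
    exact this hp
  exact ⟨hvU, (h.sub hv hU hvU).1⟩

lemma zz_two {R : Type*} [CommRing R] {x : R} {S : Finset V} {p : V} {l1 l2 : List V} 
    (hp : p ∈ S) (h1 : Tail G S p l1) (h2 : Tail G (S ∪ l1.toFinset) p l2) : 
    zz G x (S ∪ l1.toFinset ∪ l2.toFinset) = 
      ff x (l2.length + 1) * (ff x (l1.length + 1) * zz G x S + x * ff x l1.length * zz G x (S.erase p))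
      + x * ff x l2.length * (ff x (l1.length + 1) * zz G x (S.erase p) + 
        x * ff x l1.length * zz G x (S.erase p)) := by
  have e : (S ∪ l1.toFinset).erase p = S.erase p ∪ l1.toFinset := by
    rw [erase_union_distrib, erase_eq_of_notMem (s := l1.toFinset)]
    rw [List.mem_toFinset]
    exact fun h => h1.disj p h hp
  rw [zz_tail h2 subset_rfl, zz_tail h1 subset_rfl, e, zz_tail h1 (erase_subset _ _), erase_idem]

lemma zz_loop {R : Type*} [CommRing R] {x : R} {S : Finset V} {p t u : V} {l : List V} 
    (hp : p ∈ S) (h : Tail G S p (t :: l)) (hu : ¬ (u ∈ S ∨ u ∈ t :: l)) 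
    (hn : ∀ b, G.Adj u b ↔ b = t ∨ b = p) : 
    zz G x (insert u (S ∪ (t :: l).toFinset)) = 
      ff x (l.length + 2) * zz G x S + x * ff x (l.length + 1) * zz G x (S.erase p) + 
      x * (ff x (l.length + 1) * zz G x (S.erase p) + x * ff x l.length * zz G x (S.erase p)) := by
  rw [zz_close h hu hp (fun b _ => hn b), zz_tail h subset_rfl, zz_tail h.of_cons (erase_subset _ _), 
    erase_idem, List.length_cons]

lemma b2_ww (c α β : ℕ) (P P' : ℝ) (hP : P = ll (-1/4) (c + 4)) (hP' : P' = ll (-1/4) (c+3)) :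
    2 ^ (c + 4 + α + β) * (ff (-1/4 : ℝ) (β + 1) * (ff (-1/4 : ℝ) (α + 1) * P 
      + (-1/4) * ff (-1/4 : ℝ) α * P') + (-1/4) * ff (-1/4 : ℝ) β * (ff (-1/4 : ℝ) (α + 1) * P' + 
        (-1/4) * ff (-1/4 : ℝ) α * P')) = 2 - α * β := by
  rw [hP, hP']
  simp only [ff_q, ll_q, pow_add]
  push_cast
  field_simp
  ring

lemma b1_ww (a b : ℕ) (P P' : ℝ) (hP : P = ff (-1/4) (a + 4)) (hP' : P' = ff (-1/4) (a+3)) :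
    2 ^ (a + b + 4) * (ff (-1/4 : ℝ) (b + 2) * P + (-1/4) * ff (-1/4 : ℝ) (b + 1) * P' + 
      (-1/4) * (ff (-1/4 : ℝ) (b + 1) * P' + (-1/4) * ff (-1/4 : ℝ) b * P')) 
      = 2 - ((b * (a + 1) : ℕ) : ℝ) / 2 := by
  rw [hP, hP']
  simp only [ff_q, pow_add]
  push_cast
  field_simp
  ring

lemma tri_arm {R : Type*} [CommRing R] {x : R} {q y z p : V} {l : List V}
    (hqy : G.Adj q y) (hqz : G.Adj q z) (hyz : G.Adj y z) (h : Tail G {q, y, z} q (p :: l)) : 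
    zz G x ({q, y, z} ∪ (p :: l).toFinset) = ll x (l.length + 4) ∧ 
    zz G x (({q, y, z} ∪ (p :: l).toFinset).erase p) = ll x (l.length + 3) := by
  have e : ({q, y, z} : Finset V).erase q = {y, z} := erase_insert (by simp [hqy.ne, hqz.ne])
  constructor
  · rw [zz_tail h subset_rfl, zz_tri hqy hyz hqz, e, zz_pair hyz, List.length_cons, ll_eq_ff]
    simp only [ff]
    ring
  · rw [zz_tail_erase h subset_rfl, zz_tri hqy hyz hqz, e, zz_pair hyz, ll_eq_ff]
    simp only [ff]
    ring

lemma leaf_arm {R : Type*} [CommRing R] {x : R} {q p : V} {l : List V}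
    (h : Tail G {q} q (p :: l)) : 
    zz G x ({q} ∪ (p :: l).toFinset) = ff x (l.length + 4) ∧ 
    zz G x (({q} ∪ (p :: l).toFinset).erase p) = ff x (l.length + 3) := by
  constructor
  · rw [zz_tail h subset_rfl, erase_singleton, zz_single, zz_empty, List.length_cons]
    simp only [ff]
    ring
  · rw [zz_tail_erase h subset_rfl, erase_singleton, zz_single, zz_empty]
    simp only [ff]
    ring

lemma Ctx.b2_end {n : ℕ} {A : Finset V} {p : V} (h : Ctx G n A p) {B : Finset V} (hB : Clo G B)
    (hpB : p ∈ B) (hBA : ∀ U, Clo G U → p ∈ U → B ⊆ U) (c α β : ℕ) (hα : 1 ≤ α) (hβ : 1 ≤ β) 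
    (hw : ww G B = 2 - α * β) (hc : B.card = c + 4 + α + β) 
    (hz : α = 1 → β = 1 → zz G (2:ℤ) B = ll 2 (c+4) + 8 * ll 2 (c+3)) : False := by
  obtain ⟨-, j, j1, j2, j3⟩ := h.rest hB hpB hBA
  rw [hw] at j1
  have hpos : (0:ℝ) < 2 ^ j := by positivity
  have hab : α * β < 2 := by
    by_contra hm
    have : (2:ℝ) ≤ α * β := by exact_mod_cast (by omega : 2 ≤ α * β)
    nlinarith
  have ha : α = 1 := by nlinarith
  have hb : β = 1 := by nlinarith
  subst ha hb
  have hj : j = 0 := by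
    have j1' : (2:ℝ) ^ j = 2 ^ 0 := by norm_num at j1 ⊢; linarith
    exact pow_right_injective₀ (by norm_num : (0:ℝ) < 2) (by norm_num) j1'
  obtain ⟨e1, e2⟩ := j2 hj
  rw [hz rfl rfl, ll_two, ll_two, e1, hc] at e2
  have hev : Even c := by
    have := h.hodd
    rw [e1, hc, Nat.odd_iff] at this
    rw [Nat.even_iff]
    omega
  rw [pow_add (-1 : ℤ) c, pow_add (-1 : ℤ) c, hev.neg_one_pow] at e2
  have : (2:ℤ) ^ c = 2 ^ 0 := by
    ring_nf at e2 ⊢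
    linarith
  have := pow_right_injective₀ (by norm_num : (0:ℤ) < 2) (by norm_num) this
  exact h.h9 (by omega)

lemma Ctx.b2 {n : ℕ} {A : Finset V} {p : V} (h : Ctx G n A p) (hpT : ¬ InT G p) {q : V} 
    (hq : G.degree q = 3) (hqp : q ≠ p) (hconn : ∀ U, Clo G U → q ∈ U → p ∈ U) : False := by
  have hN := h.hN
  obtain ⟨y, z, hqy, hqz, hyz, ey, ez⟩ := h.htri q hq hqp
  have dy : G.degree y = 2 := by
    rcases ey with e | rfl
    · exact e
    · exact (hpT ⟨q, z, hqy.symm, hyz, hqz⟩).elim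
  have dz : G.degree z = 2 := by
    rcases ez with e | rfl
    · exact e
    · exact (hpT ⟨q, y, hqz.symm, hyz.symm, hqy⟩).elim
  rcases tri_comp hq dy dz hqy hqz hyz with ⟨C, hC, hqC, -, hCd⟩ | ⟨l, u, hT, hu, hadj, hl, hleave, hu3⟩
  · rcases hCd p (hconn C hC.1 hqC) with e | e
    · exact hqp e.symm
    · have := h.hp3; omega
  have hT0 := tight_tri hqy hyz hqz (G := G)
  by_cases hup : u = p
  swap
  · obtain ⟨b, c, hb, hc, hbc, -, -⟩ := h.htri u (by have := h.hdeg u; omega) hup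
    exact hit_tri hN hT0 hT hu hadj hb hc hbc hleave
  subst hup
  obtain ⟨hT1, u1, u2, n1, n2, n12, b1, b2, hS⟩ := arm_ext (by simp) hT hu hadj hleave h.hp3
  have hTight := tight_tail hN.pos hT0 hT1
  rw [List.headD_cons] at hTight
  have dS : dl G ({q, y, z} ∪ (u :: l).toFinset) = 2 := by
    rw [List.toFinset_cons, union_insert, dl_insert (by rw [mem_union, List.mem_toFinset]; exact hu), 
      hT.dl2 hl, h.hp3]
    unfold dl
    rw [sum_insert (by simp [hqy.ne, hqz.ne]), sum_insert (by simp [hyz.ne]), sum_singleton, 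
      hq, dy, dz]
    norm_num
  have cS : ({q, y, z} ∪ (u :: l).toFinset).card = l.length + 4 := by
    rw [hT1.cardU, card_eq_three.2 ⟨_, _, _, hqy.ne, hqz.ne, hyz.ne, rfl⟩, List.length_cons]
    ring
  have hSU : ∀ U, Clo G U → u ∈ U → {q, y, z} ∪ (u :: l).toFinset ⊆ U := by
    intro U hU huU
    obtain ⟨f1, f2⟩ := hT1.sub_rev (by simp) hU huU
    intro w hw
    rw [mem_union, List.mem_toFinset] at hw
    rcases hw with hw | hw
    · simp only [mem_insert, mem_singleton] at hw
      rcases hw with rfl | rfl | rfl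
      · exact f1
      · exact hU _ f1 _ hqy
      · exact hU _ f1 _ hqz
    · exact f2 w hw
  have hzz := fun (x : ℝ) => tri_arm (x := x) hqy hqz hyz hT1
  have hzz2 := tri_arm (x := (2:ℤ)) hqy hqz hyz hT1
  generalize hSS : {q, y, z} ∪ (u :: l).toFinset = S at *
  have huS : u ∈ S := by rw [← hSS]; simp
  have hbad : ∀ T, S ⊆ T → ∀ E : V → V → Prop, (∀ a b, E a b → a = u) → ∀ l w, Tail G T u l → 
      ¬ (w ∈ T ∨ w ∈ l) → G.Adj (l.headD u) w → 3 ≤ G.degree w → 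
      (∀ a, (a ∈ T ∨ a ∈ l) → ∀ b, ¬ (b ∈ T ∨ b ∈ l) → G.Adj a b →
          (a = l.headD u ∧ b = w) ∨ (a ∈ T ∧ E a b)) → False := by
    intro T hST E hE l' w hT' hw hadj' h3 hleave'
    have hwp : w ≠ u := by rintro rfl; exact hw (Or.inl (hST huS))
    obtain ⟨b, c, hb, hc, hbc, -, -⟩ := h.htri w (by have := h.hdeg w; omega) hwp
    refine hit_gen hN E hST hTight hT' hw hadj' hb hc hbc hleave' ?_ ?_
    · intro d hd
      obtain rfl := hE _ _ hd
      exact hpT ⟨w, c, hb.symm, hbc, hc⟩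
    · intro d hd
      obtain rfl := hE _ _ hd
      exact hpT ⟨w, b, hc.symm, hbc.symm, hb⟩
  rcases two_arms huS n1 n2 n12 b1 b2 hS hbad with
    ⟨l1, l2, c1, c2, t1, t2, hcl, hdl⟩ | ⟨t, l1, w, t1, hw, hn, hcl, hdl⟩
  · refine h.b2_end hcl (by simp [huS]) ?_ l.length l1.length l2.length c1 c2 ?_ ?_ ?_
    · intro U hU hpU w hw
      have e1 := t1.sub huS hU hpU
      have e2 := t2.sub (by simp [huS]) hU hpU
      rw [mem_union, mem_union, List.mem_toFinset, List.mem_toFinset] at hw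
      rcases hw with (hw | hw) | hw
      · exact hSU U hU hpU hw
      · exact e1.1 w hw
      · exact e2.1 w hw
    · unfold ww
      rw [zz_two huS t1 t2, t2.cardU, t1.cardU, cS]
      exact b2_ww _ _ _ _ _ (hzz _).1 (hzz _).2
    · rw [t2.cardU, t1.cardU, cS]
    · intro f1 f2
      rw [zz_two huS t1 t2, f1, f2, hzz2.1, hzz2.2]
      simp only [ff]
      ring
  · have := (h.rest hcl (by simp [huS]) (by
      intro U hU hpU w' hw'
      have e1 := t1.sub huS hU hpU
      rw [mem_insert, mem_union, List.mem_toFinset] at hw'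
      rcases hw' with rfl | hw' | hw'
      · exact hU _ hpU _ ((hn u).2 (Or.inr rfl)).symm
      · exact hSU U hU hpU hw'
      · exact e1.1 _ hw')).1
    rw [hdl, dS] at this
    norm_num at this

lemma Ctx.b1 {n : ℕ} {A : Finset V} {p : V} (h : Ctx G n A p) {B : Finset V} (hB : Clo G B) 
    (hpB : p ∈ B) (h3 : ∀ v ∈ B, G.degree v = 3 → v = p) {q : V} (hqB : q ∈ B) 
    (hq : G.degree q = 1) : False := by
  have hN := h.hN
  obtain ⟨l, u, hT, hu, hadj, hl, hleave, hu3⟩ := leaf_hit hN hq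
  have huB : u ∈ B := hB _ (hT.sub (by simp) hB hqB).2 _ hadj
  obtain rfl := h3 u huB (by have := h.hdeg u; omega)
  obtain ⟨hT1, u1, u2, n1, n2, n12, b1, b2, hS⟩ := arm_ext (by simp) hT hu hadj hleave h.hp3
  have dS : dl G ({q} ∪ (u :: l).toFinset) = 0 := by
    rw [List.toFinset_cons, union_insert, dl_insert (by rw [mem_union, List.mem_toFinset]; exact hu), 
      hT.dl2 hl, h.hp3]
    unfold dl
    rw [sum_singleton, hq]
    norm_num
  have cS : ({q} ∪ (u :: l).toFinset).card = l.length + 2 := by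
    rw [hT1.cardU, card_singleton, List.length_cons]
    ring
  have hSU : ∀ U, Clo G U → u ∈ U → {q} ∪ (u :: l).toFinset ⊆ U := by
    intro U hU huU
    obtain ⟨f1, f2⟩ := hT1.sub_rev (by simp) hU huU
    intro w hw
    rw [mem_union, List.mem_toFinset] at hw
    rcases hw with hw | hw
    · rw [mem_singleton] at hw
      exact hw ▸ f1
    · exact f2 w hw
  have hzz := fun (x : ℝ) => leaf_arm (x := x) hT1
  have hzz2 := leaf_arm (x := (2:ℤ)) hT1
  generalize hSS : {q} ∪ (u :: l).toFinset = S at *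
  have huS : u ∈ S := by rw [← hSS]; simp
  have hbad : ∀ T, S ⊆ T → ∀ E : V → V → Prop, (∀ a b, E a b → a = u) → ∀ l w, Tail G T u l → 
      ¬ (w ∈ T ∨ w ∈ l) → G.Adj (l.headD u) w → 3 ≤ G.degree w → 
      (∀ a, (a ∈ T ∨ a ∈ l) → ∀ b, ¬ (b ∈ T ∨ b ∈ l) → G.Adj a b →
          (a = l.headD u ∧ b = w) ∨ (a ∈ T ∧ E a b)) → False := by
    intro T hST E hE l' w hT' hw hadj' h3' hleave'
    have hwB : w ∈ B := hB _ (hT'.sub (hST huS) hB hpB).2 _ hadj'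
    have := h3 w hwB (by have := h.hdeg w; omega)
    exact hw (Or.inl (hST (this ▸ huS)))
  rcases two_arms huS n1 n2 n12 b1 b2 hS hbad with
    ⟨l1, l2, c1, c2, t1, t2, hcl, hdl⟩ | ⟨t, l1, w, t1, hw, hn, hcl, hdl⟩
  · have := (h.rest hcl (by simp [huS]) (by
      intro U hU hpU w hw
      have e1 := t1.sub huS hU hpU
      have e2 := t2.sub (by simp [huS]) hU hpU
      rw [mem_union, mem_union, List.mem_toFinset, List.mem_toFinset] at hw
      rcases hw with (hw | hw) | hw
      · exact hSU U hU hpU hw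
      · exact e1.1 w hw
      · exact e2.1 w hw)).1
    rw [hdl, dS] at this
    norm_num at this
  · have hcard : (insert w (S ∪ (t :: l1).toFinset)).card = l.length + l1.length + 4 := by
      rw [card_insert_of_notMem (by rw [mem_union, List.mem_toFinset]; exact hw), t1.cardU, cS, 
        List.length_cons]
      ring
    refine h.fin_end hcl (by simp [huS]) ?_ (l1.length * (l.length + 1)) ?_ ?_ ?_
    · intro U hU hpU w' hw'
      have e1 := t1.sub huS hU hpU
      rw [mem_insert, mem_union, List.mem_toFinset] at hw'
      rcases hw' with rfl | hw' | hw'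
      · exact hU _ hpU _ ((hn u).2 (Or.inr rfl)).symm
      · exact hSU U hU hpU hw'
      · exact e1.1 _ hw'
    · unfold ww
      rw [zz_loop huS t1 hw hn, hcard]
      exact b1_ww _ _ _ _ (hzz _).1 (hzz _).2
    · rw [hcard]
      generalize l.length = a
      generalize l1.length = b
      intro hm
      have : a ≤ 1 := by nlinarith [Nat.pos_of_ne_zero (n := b) (by rintro rfl; simp at hm)]
      interval_cases a <;> omega
    · rw [hcard, zz_loop huS t1 hw hn, hzz2.1, hzz2.2]
      generalize l.length = a
      generalize l1.length = b
      intro hm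
      have : a ≤ 2 := by nlinarith [Nat.pos_of_ne_zero (n := b) (by rintro rfl; simp at hm)]
      have : b ≤ 3 := by nlinarith
      interval_cases a <;> interval_cases b <;> first | omega | (constructor <;> norm_num [ff])

lemma Ctx.caseB {n : ℕ} {A : Finset V} {p : V} (h : Ctx G n A p) (hpT : ¬ InT G p) : False := by
  have hcon : ∀ U, Clo G U → ∀ a b, G.Reachable a b → a ∈ U → b ∈ U := by
    rintro U hU a b ⟨w⟩ ha
    induction w with
    | nil => exact ha
    | cons hab _ ih => exact ih (hU _ ha _ hab)
  have hB : Clo G (univ.filter (fun w => G.Reachable p w)) := by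
    intro a ha b hab
    simp only [mem_filter, mem_univ, true_and] at ha ⊢
    exact ha.trans hab.reachable
  have hpB : p ∈ univ.filter (fun w => G.Reachable p w) := by simp
  have hBA : ∀ U, Clo G U → p ∈ U → univ.filter (fun w => G.Reachable p w) ⊆ U := by
    intro U hU hpU w hw
    simp only [mem_filter, mem_univ, true_and] at hw
    exact hcon U hU _ _ hw hpU
  have hd := (h.rest hB hpB hBA).1
  by_cases hq : ∃ q ∈ univ.filter (fun w => G.Reachable p w), G.degree q = 3 ∧ q ≠ p
  · obtain ⟨q, hq1, hq2, hq3⟩ := hq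
    simp only [mem_filter, mem_univ, true_and] at hq1
    exact h.b2 hpT hq2 hq3 (fun U hU hqU => hcon U hU _ _ hq1.symm hqU)
  · push Not at hq
    by_cases hl : ∃ q ∈ univ.filter (fun w => G.Reachable p w), G.degree q = 1
    · obtain ⟨q, hq1, hq2⟩ := hl
      exact h.b1 hB hpB hq hq1 hq2
    · push Not at hl
      unfold dl at hd
      rw [sum_eq_single_of_mem p hpB, h.hp3] at hd
      · norm_num at hd
      · intro b hb hbp
        have := hl b hb
        have := h.hN.deg0 b
        have := h.hdeg b
        have : G.degree b ≠ 3 := fun e => hbp (hq b hb e)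
        have : G.degree b = 2 := by omega
        rw [this]; norm_num

end Work

section Work
open scoped Classical
open Finset
variable {V : Type*} [Fintype V] {G : SimpleGraph V}

lemma clo_tri {a b c : V} (hab : G.Adj a b) (hac : G.Adj a c) (hbc : G.Adj b c) 
    (h : Clo G {a, b, c}) : dl G {a, b, c} = 0 := by
  have key : ∀ x y z : V, G.Adj x y → G.Adj x z → y ≠ z → 
      (∀ w, G.Adj x w → w = y ∨ w = z) → G.degree x = 2 := by
    intro x y z hxy hxz hyz hw
    rw [← G.card_neighborFinset_eq_degree, card_eq_two]
    refine ⟨y, z, hyz, ?_⟩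
    ext w
    rw [G.mem_neighborFinset, mem_insert, mem_singleton]
    refine ⟨hw w, ?_⟩
    rintro (rfl | rfl) <;> assumption
  have da : G.degree a = 2 := key a b c hab hac hbc.ne (by
    intro w hw
    have := h a (by simp) w hw
    have := hw.ne'
    simp at *; tauto)
  have db : G.degree b = 2 := key b a c hab.symm hbc hac.ne (by
    intro w hw
    have := h b (by simp) w hw
    have := hw.ne'
    simp at *; tauto)
  have dc : G.degree c = 2 := key c a b hac.symm hbc.symm hab.ne (by
    intro w hw
    have := h c (by simp) w hw
    have := hw.ne'
    simp at *; tauto)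
  unfold dl
  rw [sum_insert (by simp [hab.ne, hac.ne]), sum_insert (by simp [hbc.ne]), sum_singleton, da, db, dc]
  norm_num

theorem mainThm {n : ℕ} (hn : 5 ≤ n) (hodd : Odd n)
    (h9 : n ≠ 9) (h15 : n ≠ 15) (h : G.indepPoly = (cycleGraph n).indepPoly) :
    Nonempty (G ≃g cycleGraph n) ∨ Nonempty (G ≃g Dgraph n) := by
  have hX : zz G (X : ℚ[X]) univ = ll X n := by
    have := h
    rw [indepPoly_eq, indepPoly_eq] at this
    rw [this]
    convert cyc_zz (by omega : 4 ≤ n) ℚ[X] X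
  have hR : ∀ x : ℝ, zz G x univ = ll x n := by
    intro x
    have e := congrArg ((aeval x : ℚ[X] →ₐ[ℚ] ℝ) : ℚ[X] →+* ℝ) hX
    rw [zz_map, map_ll] at e
    simpa using e
  have hZ : zz G (2:ℤ) univ = 2 ^ n - 1 := by
    have e := congrArg (evalRingHom (2:ℚ)) hX
    rw [zz_map, map_ll] at e
    have e2 : ((Int.castRingHom ℚ) (zz G (2:ℤ) univ)) = (Int.castRingHom ℚ) (ll 2 n) := by
      rw [zz_map, map_ll]
      simpa using e
    rw [← ll_two_odd hodd]
    exact (Int.castRingHom ℚ).injective_int e2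
  have hu : Clo G (univ : Finset V) := fun _ _ _ _ => mem_univ _
  have hdvd : ∀ C, Clo G C → zz G (2:ℤ) C ∣ 2 ^ n - 1 := by
    intro C hC
    rw [← hZ, zz_clo hC (subset_univ C)]
    exact dvd_mul_right _ _
  have hN : Nice G := by
    refine ⟨?_, ?_, ?_, ?_⟩
    · intro S
      have := pos_aux (G := G) _ univ rfl (1/4) (by norm_num) (by
        intro t ht
        rw [hR]
        exact ll_pos ht.1 ht.2 n) S (subset_univ S) (1/4) (by norm_num)
      rwa [show (-1/4 : ℝ) = -(1/4) by norm_num]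
    · intro C hC e
      have := hdvd C hC
      rw [e] at this
      exact not13 hodd this
    · intro C hC k hk e
      have := hdvd C hC
      rw [e] at this
      exact path_not hodd hk this
    · intro v hv
      have hC : Clo G {v} := by
        intro a ha b hab
        rw [mem_singleton] at ha
        subst ha
        have : 0 < G.degree a := (G.degree_pos_iff_exists_adj a).2 ⟨b, hab⟩
        omega
      have := hdvd _ hC
      rw [zz_single] at this
      exact not3 hodd (by simpa using this)
  have h33 : ∀ C, Clo G C → zz G (X : ℚ[X]) C ≠ (1 + 3 * X) * (1 + 3 * X) := by
    intro C hC e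
    obtain ⟨m, rfl⟩ : ∃ m, n = m + 1 := ⟨n - 1, by omega⟩
    rw [zz_clo hC (subset_univ C), e] at hX
    exact ll_simple hX.symm
  obtain ⟨hV, hd, hsq⟩ := counting (by omega) h
  have hw : ww G univ = 2 := by
    unfold ww
    rw [hR, card_univ, hV, ll_quarter]
  rcases structureThm hN h33 hd hsq with hs | ⟨a, b, c, p, hab, hac, hbc, hA, hp, hp3, hdeg, htri, hcase⟩
  · obtain ⟨j, j1, -, -, j4⟩ := peel_all hN hu hs
    rw [hw] at j1
    have hj : j = 1 := by
      have : (2:ℝ) ^ j = 2 ^ 1 := by rw [← j1]; norm_num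
      exact pow_right_injective₀ (by norm_num : (0:ℝ) < 2) (by norm_num) this
    exact comp_iso (by omega) hV (j4 hj)
  · exfalso
    have cA : ({a, b, c} : Finset V).card = 3 := 
      card_eq_three.2 ⟨_, _, _, hab.ne, hac.ne, hbc.ne, rfl⟩
    have hctx : Ctx G n {a, b, c} p := {
      hN := hN, hodd := hodd, h9 := h9, h15 := h15, hV := hV, hw := hw, hz := hZ, hd := hd
      hA := hA
      wA := by
        unfold ww
        rw [cA, zz_tri hab hbc hac]; norm_num
      zA := by rw [zz_tri hab hbc hac]; norm_num
      dA := clo_tri hab hac hbc hA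
      cA := cA, hp := hp, hp3 := hp3, hdeg := hdeg, htri := htri }
    rcases hcase with hc | ⟨q, z, h1, h2, h3, h4, h5⟩
    · exact hctx.caseB hc
    · exact hctx.caseA h1 h2 h3 h4 h5

end Work
/-- For odd `n ≥ 5` with `n ≠ 9` and `n ≠ 15`, any finite simple graph with the same
independence polynomial as `C_n` is isomorphic to `C_n` or to `D_n`. -/
theorem indep_equiv_class_Cn_odd {n : ℕ} (hn : 5 ≤ n) (hodd : Odd n)
    (h9 : n ≠ 9) (h15 : n ≠ 15) {V : Type} [Fintype V] (H : SimpleGraph V)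
    (h : H.indepPoly = (cycleGraph n).indepPoly) :
    Nonempty (H ≃g cycleGraph n) ∨ Nonempty (H ≃g Dgraph n) := by
  exact mainThm hn hodd h9 h15 h
end

section
/- Let n ≥ 3 be an odd integer and let i be a positive integer with 1 ≤ i ≤ ⌊n/2⌋ and gcd(2i−1, n) = 1. Set c_i = −1/(2 + 2cos((2i−1)π/n)). Then c_i is an algebraic number whose minimal polynomial over ℚ has degree φ(n)/2 (where φ is Euler's totient function), and this minimal polynomial divides the independence polynomial I(C_n,x) in ℚ[x]. -/
open Polynomial SimpleGraph

lemma aux_path {ι R : Type*} [Fintype ι] [DecidableEq ι] [CommRing R] (M : Matrix ι ι R) (n : ℕ) :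
    ∀ g : ι → ι → R, ∑ f : Fin (n+1) → ι,
      (∏ j : Fin n, M (f j.castSucc) (f j.succ)) * g (f 0) (f (Fin.last n))
      = ∑ a, ∑ b, (M ^ n) a b * g a b := by
  induction n with
  | zero =>
    intro g
    rw [← (Equiv.funUnique (Fin 1) ι).symm.sum_comp]
    simp [Matrix.one_apply]
  | succ n ih =>
    intro g
    rw [← (Fin.consEquiv (fun _ => ι)).sum_comp, Fintype.sum_prod_type]
    refine Finset.sum_congr rfl fun a _ => ?_
    have := ih (fun c b => M a c * g a b)
    trans ∑ f : Fin (n+1) → ι, (∏ j : Fin n, M (f j.castSucc) (f j.succ)) *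
      (M a (f 0) * g a (f (Fin.last n)))
    · refine Finset.sum_congr rfl fun f _ => ?_
      rw [Fin.prod_univ_succ]
      simp only [Fin.consEquiv_apply, Fin.castSucc_zero, Fin.cons_zero, Fin.cons_succ,
        ← Fin.succ_castSucc, ← Fin.succ_last]
      ring
    · rw [this, Finset.sum_comm]
      refine Finset.sum_congr rfl fun b _ => ?_
      rw [pow_succ', Matrix.mul_apply, Finset.sum_mul]
      refine Finset.sum_congr rfl fun c _ => ?_
      ring

def auxM (x : ℂ) : Matrix Bool Bool ℂ :=
  fun a b => (if a = true ∧ b = true then 0 else 1) * (if a = true then x else 1)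

lemma auxM_sq (x : ℂ) : auxM x * auxM x = auxM x + x • 1 := by
  ext a b
  cases a <;> cases b <;> simp [Matrix.mul_apply, auxM, add_comm]

lemma auxM_trace (x a b : ℂ) (hab : a + b = 1) (hx : a * b = -x) (n : ℕ) :
    ((auxM x) ^ n).trace = a ^ n + b ^ n := by
  induction n using Nat.twoStepInduction with
  | zero => simp; norm_num
  | one => simp [Matrix.trace, auxM, hab]
  | more n h1 h2 =>
    have : auxM x ^ (n+2) = auxM x ^ (n+1) + x • auxM x ^ n := by
      rw [pow_add, pow_two, auxM_sq, mul_add, pow_succ]; simp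
    rw [this, Matrix.trace_add, Matrix.trace_smul, h1, h2]
    have hb : b = 1 - a := by linear_combination hab
    have hx' : x = -(a * b) := by rw [hx, neg_neg]
    subst hx'; subst hb
    simp only [smul_eq_mul]; ring

lemma aux_indep (n : ℕ) (hn : 2 ≤ n) (s : Finset (Fin (n+1))) :
    (cycleGraph (n+1)).IsIndepFinset s ↔
      (∀ j : Fin n, ¬ (j.castSucc ∈ s ∧ j.succ ∈ s)) ∧ ¬ (Fin.last n ∈ s ∧ (0 : Fin (n+1)) ∈ s) := by
  obtain ⟨m, rfl⟩ : ∃ m, n = m + 1 := ⟨n - 1, by omega⟩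
  have key : ∀ v w : Fin (m+1+1), v - w = 1 ↔
      (∃ j : Fin (m+1), w = j.castSucc ∧ v = j.succ) ∨ (w = Fin.last _ ∧ v = 0) := by
    intro v w
    rw [sub_eq_iff_eq_add]
    induction w using Fin.lastCases with
    | last =>
      rw [add_comm 1 (Fin.last (m+1)), Fin.last_add_one]
      constructor
      · intro h; right; exact ⟨rfl, h⟩
      · rintro (⟨j, h, _⟩ | ⟨_, h⟩)
        · exact absurd h.symm (Fin.castSucc_lt_last j).ne
        · exact h
    | cast j =>
      rw [add_comm 1 j.castSucc, Fin.coeSucc_eq_succ]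
      constructor
      · intro h; left; exact ⟨j, rfl, h⟩
      · rintro (⟨k, h, h2⟩ | ⟨h, _⟩)
        · rw [Fin.castSucc_inj] at h; rw [h2, h]
        · exact absurd h (Fin.castSucc_lt_last j).ne
  unfold SimpleGraph.IsIndepFinset
  simp only [cycleGraph_adj, key]
  constructor
  · intro h
    refine ⟨fun j hj => h _ hj.1 _ hj.2 (Or.inr (Or.inl ⟨j, rfl, rfl⟩)), fun hj => ?_⟩
    exact h _ hj.1 _ hj.2 (Or.inr (Or.inr ⟨rfl, rfl⟩))
  · rintro ⟨h1, h2⟩ v hv w hw ((⟨j, rfl, rfl⟩ | ⟨rfl, rfl⟩) | (⟨j, rfl, rfl⟩ | ⟨rfl, rfl⟩))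
    · exact h1 j ⟨hw, hv⟩
    · exact h2 ⟨hw, hv⟩
    · exact h1 j ⟨hv, hw⟩
    · exact h2 ⟨hv, hw⟩

lemma aux_eval (n : ℕ) (hn : 2 ≤ n) (x : ℂ) :
    aeval x (cycleGraph (n+1)).indepPoly = ((auxM x) ^ (n+1)).trace := by
  classical
  have h := aux_path (auxM x) n (fun a b => auxM x b a)
  have h2 : ∑ a, ∑ b, (auxM x ^ n) a b * auxM x b a = ((auxM x) ^ (n+1)).trace := by
    simp only [Matrix.trace, Matrix.diag, pow_succ, Matrix.mul_apply]
  rw [← h2, ← h]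
  unfold SimpleGraph.indepPoly
  rw [map_sum]
  let e : Finset (Fin (n+1)) ≃ (Fin (n+1) → Bool) :=
    { toFun := fun s j => decide (j ∈ s)
      invFun := fun f => Finset.univ.filter (fun j => f j = true)
      left_inv := fun s => by ext; simp
      right_inv := fun f => by ext; simp }
  refine Fintype.sum_equiv e _ _ fun s => ?_
  have he : ∀ j, e s j = true ↔ j ∈ s := fun j => by simp [e]
  simp only [auxM, he, Finset.prod_mul_distrib]
  have hc : x ^ s.card = (∏ j : Fin n, if j.castSucc ∈ s then x else 1) *
      (if Fin.last n ∈ s then x else 1) := by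
    rw [← Fin.prod_univ_castSucc (fun j => if j ∈ s then x else 1)]
    simp
  rw [aux_indep n hn]
  by_cases h1 : ∀ j : Fin n, ¬ (j.castSucc ∈ s ∧ j.succ ∈ s)
  · have : (∏ j : Fin n, if j.castSucc ∈ s ∧ j.succ ∈ s then (0:ℂ) else 1) = 1 :=
      Finset.prod_eq_one fun j _ => by rw [if_neg (h1 j)]
    rw [this]
    by_cases h3 : Fin.last n ∈ s ∧ (0 : Fin (n+1)) ∈ s
    · rw [if_neg (by tauto), if_pos h3]; simp
    · rw [if_pos ⟨h1, h3⟩, if_neg h3, map_pow, aeval_X, hc]; ring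
  · rw [if_neg (by tauto)]
    push Not at h1
    obtain ⟨j, hj⟩ := h1
    rw [Finset.prod_eq_zero (Finset.mem_univ j) (by rw [if_pos hj])]; simp

lemma aux_root (n : ℕ) (hn : 3 ≤ n) (z : ℂ) (hz : z ^ n = -1) (hz1 : 1 + z ≠ 0) (hz0 : z ≠ 0) :
    aeval (-1 / (2 + z + z⁻¹)) (cycleGraph n).indepPoly = 0 := by
  obtain ⟨m, rfl⟩ : ∃ m, n = m + 1 := ⟨n - 1, by omega⟩
  have h2 : 2 + z + z⁻¹ = (1 + z) ^ 2 / z := by field_simp; ring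
  rw [aux_eval m (by omega), auxM_trace _ (1 / (1 + z)) (z / (1 + z))]
  · rw [div_pow, div_pow, hz]; simp; ring
  · field_simp
  · rw [h2]; field_simp

open IntermediateField in
lemma aux_tower {F E : Type*} [Field F] [Field E] [Algebra F E] (c w : E)
    (hcint : IsIntegral F c) (hwint : IsIntegral F w) (hcmem : c ∈ F⟮w⟯)
    (hdeg2 : (minpoly F⟮c⟯ w).natDegree = 2) :
    (minpoly F w).natDegree = (minpoly F c).natDegree * 2 := by
  have hwint' : IsIntegral F⟮c⟯ w := hwint.tower_top
  have hA : Module.finrank F F⟮c⟯ = (minpoly F c).natDegree := adjoin.finrank hcint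
  have hB : Module.finrank F⟮c⟯ (F⟮c⟯)⟮w⟯ = 2 := by rw [adjoin.finrank hwint', hdeg2]
  have hC : Module.finrank F F⟮w⟯ = (minpoly F w).natDegree := adjoin.finrank hwint
  have hE : ((F⟮c⟯)⟮w⟯).restrictScalars F = F⟮w⟯ := by
    rw [adjoin_simple_adjoin_simple]
    apply le_antisymm
    · rw [adjoin_le_iff]
      rintro y (rfl | rfl)
      · exact hcmem
      · exact mem_adjoin_simple_self F _
    · exact adjoin.mono _ _ _ (by simp)
  have hD : Module.finrank F (F⟮c⟯)⟮w⟯ = (minpoly F w).natDegree := by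
    rw [← hC, ← hE]; rfl
  have := Module.finrank_mul_finrank F F⟮c⟯ (F⟮c⟯)⟮w⟯
  rw [hA, hB, hD] at this
  exact this.symm

open IntermediateField in
lemma aux_degree (n : ℕ) (hn : 3 ≤ n) (w : ℂ) (hw : IsPrimitiveRoot w n) (c : ℝ)
    (hc : (c : ℂ) = -1 / (2 - w - w⁻¹)) :
    (minpoly ℚ (c : ℂ)).natDegree = n.totient / 2 := by
  have hw0 : w ≠ 0 := hw.ne_zero (by omega)
  have hw1 : 1 - w ≠ 0 := by
    intro h
    exact hw.ne_one (by omega) (by linear_combination -h)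
  have h2 : 2 - w - w⁻¹ = -(1 - w) ^ 2 / w := by field_simp; ring
  have hc0 : (c : ℂ) ≠ 0 := by
    rw [hc, h2]; field_simp; simp [hw0, hw1]
  have hrel : w ^ 2 - (2 + 1 / (c:ℂ)) * w + 1 = 0 := by
    rw [hc, h2]; field_simp; ring
  have hwint : IsIntegral ℚ w := (hw.isIntegral (by omega)).tower_top
  have hwint' : IsIntegral ℚ⟮(c:ℂ)⟯ w := hwint.tower_top
  have hcmem : (c : ℂ) ∈ ℚ⟮w⟯ := by
    rw [hc]
    have := mem_adjoin_simple_self ℚ w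
    exact div_mem (neg_mem (one_mem _)) (sub_mem (sub_mem (ofNat_mem _ 2) this) (inv_mem this))
  have hcint : IsIntegral ℚ (c : ℂ) := by
    have := adjoin.finiteDimensional hwint
    exact (isIntegral_algebraMap_iff (algebraMap ℚ⟮w⟯ ℂ).injective).2
      (IsIntegral.of_finite ℚ (⟨c, hcmem⟩ : ℚ⟮w⟯))
  -- real-ness
  have hreal : ∀ y ∈ ℚ⟮(c:ℂ)⟯, (starRingEnd ℂ) y = y := by
    intro y hy
    induction hy using adjoin_induction with
    | mem x hx => rw [Set.mem_singleton_iff.1 hx]; exact Complex.conj_ofReal c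
    | algebraMap x => simp
    | add x y _ _ hx hy => rw [map_add, hx, hy]
    | inv x _ hx => rw [map_inv₀, hx]
    | mul x y _ _ hx hy => rw [map_mul, hx, hy]
  have hwn : w ∉ ℚ⟮(c:ℂ)⟯ := by
    intro h
    have h1 := hreal w h
    have h3 : ‖w‖ = 1 := hw.norm'_eq_one (by omega)
    have h4 : w * w = 1 := by
      have := Complex.mul_conj' w
      rw [h1, h3] at this; simpa using this
    have := hw.dvd_of_pow_eq_one 2 (by rw [pow_two, h4])
    have := Nat.le_of_dvd (by norm_num) this
    omega
  have hdeg2 : (minpoly ℚ⟮(c:ℂ)⟯ w).natDegree = 2 := by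
    apply le_antisymm
    · let g : ℚ⟮(c:ℂ)⟯ := AdjoinSimple.gen ℚ (c:ℂ)
      let p : (ℚ⟮(c:ℂ)⟯)[X] := X ^ 2 + (C (-(2 + 1 / g)) * X + C 1)
      have hpm : p.natDegree = 2 := by
        simp only [p]; compute_degree!
      have hp0 : p ≠ 0 := by intro h; rw [h] at hpm; simp at hpm
      have hpr : aeval w p = 0 := by
        simp only [p, map_add, map_mul, map_pow, aeval_X, aeval_C]
        have hg : (algebraMap ℚ⟮(c:ℂ)⟯ ℂ) g = c := rfl
        simp only [map_neg, map_add, map_div₀, map_one, hg, map_ofNat]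
        linear_combination hrel
      rw [← hpm]
      exact natDegree_le_of_dvd (minpoly.dvd _ _ hpr) hp0
    · rw [minpoly.two_le_natDegree_iff hwint']
      rintro ⟨y, hy⟩
      exact hwn (hy ▸ y.2)
  have hC : (minpoly ℚ w).natDegree = n.totient := by
    rw [← cyclotomic_eq_minpoly_rat hw (by omega), natDegree_cyclotomic]
  have := aux_tower (c : ℂ) w hcint hwint hcmem hdeg2
  omega

/-- For odd `n ≥ 3` and `1 ≤ i ≤ ⌊n/2⌋` with `gcd(2i-1, n) = 1`, the number
`c_i = -1/(2 + 2cos((2i-1)π/n))` is algebraic over `ℚ`, its minimal polynomial over `ℚ`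
has degree `φ(n)/2`, and this minimal polynomial divides `I(C_n, x)` in `ℚ[x]`. -/
theorem minpoly_root_dvd_indepPoly_cycle (n i : ℕ) (hn : 3 ≤ n) (hodd : Odd n)
    (hi1 : 1 ≤ i) (hi2 : i ≤ n / 2) (hgcd : Nat.gcd (2 * i - 1) n = 1) :
    IsAlgebraic ℚ (-1 / (2 + 2 * Real.cos (((2 * i - 1 : ℕ) : ℝ) * Real.pi / n))) ∧
    (minpoly ℚ (-1 / (2 + 2 * Real.cos (((2 * i - 1 : ℕ) : ℝ) * Real.pi / n)))).natDegree
      = n.totient / 2 ∧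
    minpoly ℚ (-1 / (2 + 2 * Real.cos (((2 * i - 1 : ℕ) : ℝ) * Real.pi / n)))
      ∣ (cycleGraph n).indepPoly := by
  have hn0 : n ≠ 0 := by omega
  set θ : ℝ := ((2 * i - 1 : ℕ) : ℝ) * Real.pi / n with hθ
  set c : ℝ := -1 / (2 + 2 * Real.cos θ) with hcdef
  set z : ℂ := Complex.exp (θ * Complex.I) with hz
  have hz0 : z ≠ 0 := Complex.exp_ne_zero _
  have hcos : (2 * Real.cos θ : ℂ) = z + z⁻¹ := by
    rw [Complex.ofReal_cos, Complex.two_cos, hz, ← Complex.exp_neg, neg_mul]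
  have hcC : (c : ℂ) = -1 / (2 + z + z⁻¹) := by
    rw [add_assoc, ← hcos, hcdef]; push_cast; rfl
  obtain ⟨k, hk⟩ : ∃ k, 2 * k = 2 * i - 1 + n := by
    obtain ⟨r, hr⟩ := hodd
    exact ⟨i + r, by omega⟩
  have hkn : k.Coprime n := by
    have : (2 * k).Coprime n := by
      rw [hk]; simpa [Nat.Coprime] using hgcd
    exact this.coprime_mul_left
  have hw : IsPrimitiveRoot (-z) n := by
    have := Complex.isPrimitiveRoot_exp_of_coprime k n hn0 hkn
    convert this using 1
    rw [hz, neg_eq_neg_one_mul, ← Complex.exp_pi_mul_I, ← Complex.exp_add]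
    congr 1
    have hk' : (2 * k : ℂ) = ((2 * i - 1 : ℕ) : ℂ) + n := by exact_mod_cast hk
    have hn' : (n : ℂ) ≠ 0 := by exact_mod_cast hn0
    rw [hθ]
    push_cast [-Nat.cast_sub, -Nat.cast_pred]
    field_simp
    linear_combination (-1 : ℂ) * hk'
  have hzn : z ^ n = -1 := by
    have := hw.pow_eq_one
    rw [hodd.neg_pow] at this
    linear_combination -this
  have hz1 : 1 + z ≠ 0 := fun h => hw.ne_one (by omega) (by linear_combination -h)
  have hroot : aeval (c : ℂ) (cycleGraph n).indepPoly = 0 := by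
    rw [hcC]; exact aux_root n hn z hzn hz1 hz0
  have hdeg := aux_degree n hn (-z) hw c (by rw [hcC]; congr 1; rw [inv_neg]; ring)
  have hmp : minpoly ℚ (c : ℂ) = minpoly ℚ c :=
    minpoly.algebraMap_eq (algebraMap ℝ ℂ).injective c
  rw [hmp] at hdeg
  have hroot' : aeval c (cycleGraph n).indepPoly = 0 := by
    have : algebraMap ℝ ℂ (aeval c (cycleGraph n).indepPoly) = 0 := by
      rw [← aeval_algebraMap_apply]; exact hroot
    exact (map_eq_zero _).1 this
  refine ⟨?_, hdeg, minpoly.dvd _ _ hroot'⟩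
  have hpos : 0 < (minpoly ℚ c).natDegree := by
    rw [hdeg]
    have h1 := Nat.totient_even (n := n) (by omega)
    have h2 := Nat.totient_pos.2 (show 0 < n by omega)
    obtain ⟨r, hr⟩ := h1
    omega
  by_contra h
  rw [minpoly.eq_zero (fun h' => h h'.isAlgebraic)] at hpos
  simp at hpos
end
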